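/- arXiv:math/0410476 — 2 statements merged into one kernel-verified Lean document; each statement's English description precedes it below -/
import Mathlib

section
/- Let n ≥ 1 and let f : S^n → S^{n+1} be a continuous map whose set of injectivity I contains the closed metric ball D := {x ∈ S^n : |x − x₀| ≤ r} for some x₀ ∈ S^n and 0 < r < 1, and let U₁, U₂ be the two connected components of S^{n+1} \ f(S^n) whose closures intersect f(D°). Then for every p ∈ D° and every ε > 0 there exists δ with 0 < δ ≤ ε such that the set B(f(p), δ) \ f(S^n) is contained in the union of the two connected components of B(f(p), ε) \ f(S^n) which contain f(p) in their closure, where B(f(p), t) denotes the open metric ball in S^{n+1} of radius t centered at f(p). -/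
/-- `C` is a connected component of the subset `S` of a topological space. -/
def IsConnCompIn {α : Type*} [TopologicalSpace α] (S C : Set α) : Prop :=
  ∃ x ∈ S, C = connectedComponentIn S x

/-! ### Maps equal to the identity near infinity have a zero -/

section NoRetraction

open MeasureTheory Metric Set Filter Topology

/-- The value at `1` of a real polynomial of degree at most `N` is a fixed linear combination of its
values at finitely many points of `(0, t₀]`. -/
theorem exists_nodes_eval_one_eq_sum (N : ℕ) {t₀ : ℝ} (ht₀ : 0 < t₀) :
    ∃ a v : ℕ → ℝ, (∀ i, 0 < v i ∧ v i ≤ t₀) ∧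
      ∀ p : Polynomial ℝ, p.natDegree ≤ N →
        p.eval 1 = ∑ i ∈ Finset.range (N + 1), a i * p.eval (v i) := by
  set v : ℕ → ℝ := fun i => t₀ / (i + 1) with hv
  refine ⟨fun i => (Lagrange.basis (Finset.range (N + 1)) v i).eval 1, v, fun i => ?_, ?_⟩
  · have : (0 : ℝ) < i + 1 := by positivity
    exact ⟨by positivity, div_le_self ht₀.le (by linarith)⟩
  · intro p hp
    have hinj : Set.InjOn v (Finset.range (N + 1)) := by
      intro i _ j _ hij
      have hi : (i : ℝ) + 1 ≠ 0 := by positivity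
      have hj : (j : ℝ) + 1 ≠ 0 := by positivity
      simp only [hv] at hij
      rw [div_eq_div_iff hi hj] at hij
      have := mul_left_cancel₀ ht₀.ne' hij
      exact_mod_cast (by linarith : (i : ℝ) = j)
    have hdeg : p.degree < (Finset.range (N + 1)).card := by
      rw [Finset.card_range]
      exact lt_of_le_of_lt Polynomial.degree_le_natDegree (by exact_mod_cast Nat.lt_succ_of_le hp)
    have h := congrArg (Polynomial.eval 1) (Lagrange.eq_interpolate hinj hdeg)
    rw [Lagrange.interpolate_apply, Polynomial.eval_finsetSum] at h
    rw [h]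
    refine Finset.sum_congr rfl fun i _ => ?_
    rw [Polynomial.eval_mul, Polynomial.eval_C, mul_comm]

variable {V : Type*} [NormedAddCommGroup V] [InnerProductSpace ℝ V] [FiniteDimensional ℝ V]

theorem exists_polynomial_eval_eq_det_one_add_smul (A : V →L[ℝ] V) :
    ∃ p : Polynomial ℝ, p.natDegree ≤ Module.finrank ℝ V ∧
      ∀ t : ℝ, p.eval t = (ContinuousLinearMap.id ℝ V + t • A).det := by
  classical
  set b := Module.finBasis ℝ V
  set M := LinearMap.toMatrix b b (A : V →ₗ[ℝ] V) with hM
  refine ⟨((Polynomial.X : Polynomial ℝ) • M.map Polynomial.C +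
    (1 : Matrix (Fin (Module.finrank ℝ V)) (Fin (Module.finrank ℝ V)) ℝ).map Polynomial.C).det, ?_, fun t => ?_⟩
  · simpa using Polynomial.natDegree_det_X_add_C_le M 1
  · have h1 : (ContinuousLinearMap.id ℝ V + t • A).det = (1 + t • M).det := by
      rw [ContinuousLinearMap.det, ← LinearMap.det_toMatrix b]
      congr 1
      simp [hM]
    rw [h1, ← Polynomial.coe_evalRingHom, RingHom.map_det]
    congr 1
    ext i j
    by_cases hij : i = j <;> simp [hij] <;> ring

theorem exists_polynomial_eval_eq_pow_mul_det (w e : V) (A : V →L[ℝ] V) (M : ℝ) (k : ℕ) :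
    ∃ p : Polynomial ℝ, p.natDegree ≤ 2 * k + Module.finrank ℝ V ∧
      ∀ t : ℝ, p.eval t =
        (1 - ‖w + t • e‖ ^ 2 / M ^ 2) ^ k * (ContinuousLinearMap.id ℝ V + t • A).det := by
  obtain ⟨q, hq, hqe⟩ := exists_polynomial_eval_eq_det_one_add_smul A
  set s : Polynomial ℝ := Polynomial.C (-(‖e‖ ^ 2 / M ^ 2)) * Polynomial.X ^ 2 +
    Polynomial.C (-(2 * inner ℝ w e / M ^ 2)) * Polynomial.X + Polynomial.C (1 - ‖w‖ ^ 2 / M ^ 2)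
    with hs
  have hsd : s.natDegree ≤ 2 := Polynomial.natDegree_quadratic_le
  refine ⟨s ^ k * q, ?_, fun t => ?_⟩
  · refine Polynomial.natDegree_mul_le.trans (add_le_add ?_ hq)
    refine Polynomial.natDegree_pow_le.trans ?_
    rw [mul_comm]
    exact Nat.mul_le_mul_right k hsd
  · rw [Polynomial.eval_mul, Polynomial.eval_pow, hqe]
    congr 2
    rw [norm_add_sq_real, norm_smul, mul_pow, Real.norm_eq_abs, sq_abs, inner_smul_right]
    simp [hs]
    ring

/-- Change of variables for a small perturbation of the identity supported in a ball. -/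
theorem exists_pos_forall_setIntegral_det_eq [MeasurableSpace V] [BorelSpace V] (μ : Measure V)
    [μ.IsAddHaarMeasure] {η : V → V} (hη : ContDiff ℝ 1 η) {R : ℝ}
    (hR : ∀ z, R ≤ ‖z‖ → η z = 0) :
    ∃ t₀ : ℝ, 0 < t₀ ∧ ∀ t : ℝ, 0 < t → t ≤ t₀ → ∀ g : V → ℝ,
      ∫ z in closedBall 0 R, g (z + t • η z) * (ContinuousLinearMap.id ℝ V + t • fderiv ℝ η z).det ∂μ =
        ∫ z in closedBall 0 R, g z ∂μ := by
  have hsupp : HasCompactSupport η := by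
    refine HasCompactSupport.intro (isCompact_closedBall (0 : V) R) fun z hz => hR z ?_
    simp at hz
    exact hz.le
  obtain ⟨C, hC⟩ := hη.lipschitzWith_of_hasCompactSupport hsupp one_ne_zero
  have hdet : ∀ᶠ A : V →L[ℝ] V in 𝓝 (ContinuousLinearMap.id ℝ V), 0 < A.det := by
    refine ContinuousLinearMap.continuous_det.continuousAt.eventually (lt_mem_nhds ?_)
    simp [ContinuousLinearMap.det]
  obtain ⟨e, he, hdet⟩ := Metric.eventually_nhds_iff.1 hdet
  have hC1 : (0 : ℝ) < C + 1 := by positivity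
  refine ⟨min e 1 / (2 * (C + 1)), by positivity, fun t ht ht' g => ?_⟩
  have htC : t * C < min e 1 := by
    have h1 : t * (2 * (C + 1)) ≤ min e 1 := (le_div_iff₀ (by positivity)).1 ht'
    have h2 : 0 ≤ t * C := by positivity
    nlinarith
  set φ : V → V := fun z => z + t • η z with hφ
  have happ : ApproximatesLinearOn φ ((ContinuousLinearEquiv.refl ℝ V : V ≃L[ℝ] V) : V →L[ℝ] V)
      univ (Real.toNNReal (t * C)) := by
    intro x _ y _
    have : φ x - φ y - ((ContinuousLinearEquiv.refl ℝ V : V ≃L[ℝ] V) : V →L[ℝ] V) (x - y) =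
        t • (η x - η y) := by
      simp [hφ, smul_sub]; abel
    rw [this, norm_smul, Real.norm_of_nonneg ht.le, Real.coe_toNNReal _ (by positivity), mul_assoc]
    exact mul_le_mul_of_nonneg_left (hC.norm_sub_le x y) ht.le
  have hsmall : Subsingleton V ∨ Real.toNNReal (t * C) <
      ‖((ContinuousLinearEquiv.refl ℝ V : V ≃L[ℝ] V).symm : V →L[ℝ] V)‖₊⁻¹ := by
    rcases subsingleton_or_nontrivial V with h | h
    · exact Or.inl h
    · right
      have : ‖((ContinuousLinearEquiv.refl ℝ V : V ≃L[ℝ] V).symm : V →L[ℝ] V)‖₊ = 1 := by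
        ext; simp
      rw [this, inv_one, Real.toNNReal_lt_one]
      exact htC.trans_le (min_le_right _ _)
  let Φ : V ≃ₜ V := happ.toHomeomorph φ hsmall
  have hΦ : ∀ z, Φ z = φ z := fun z => rfl
  have hinj : Function.Injective φ := Φ.injective
  have hfix : ∀ z, R < ‖z‖ → φ z = z := fun z hz => by simp [hφ, hR z hz.le]
  have himage : φ '' closedBall 0 R = closedBall 0 R := by
    apply Subset.antisymm
    · rintro _ ⟨z, hz, rfl⟩
      by_contra hcon
      simp only [mem_closedBall, dist_zero_right, not_le] at hcon hz
      have := hinj (hfix _ hcon)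
      rw [this] at hcon
      exact absurd hz (not_le.2 hcon)
    · intro z hz
      obtain ⟨w, hw⟩ := Φ.surjective z
      rw [hΦ] at hw
      refine ⟨w, ?_, hw⟩
      by_contra hcon
      simp only [mem_closedBall, dist_zero_right, not_le] at hcon hz
      rw [hfix _ hcon] at hw
      rw [hw] at hcon
      exact absurd hz (not_le.2 hcon)
  have hderiv : ∀ z, HasFDerivAt φ (ContinuousLinearMap.id ℝ V + t • fderiv ℝ η z) z := fun z =>
    (hasFDerivAt_id z).add (((hη.differentiable one_ne_zero) z).hasFDerivAt.const_smul t)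
  have key := integral_image_eq_integral_abs_det_fderiv_smul μ
    (measurableSet_closedBall (x := (0 : V)) (ε := R))
    (fun z _ => (hderiv z).hasFDerivWithinAt) hinj.injOn g
  rw [himage] at key
  rw [key]
  refine setIntegral_congr_fun measurableSet_closedBall fun z _ => ?_
  have hpos : 0 < (ContinuousLinearMap.id ℝ V + t • fderiv ℝ η z).det := by
    apply hdet
    rw [dist_eq_norm, add_sub_cancel_left, norm_smul, Real.norm_of_nonneg ht.le]
    calc t * ‖fderiv ℝ η z‖ ≤ t * C :=
          mul_le_mul_of_nonneg_left (norm_fderiv_le_of_lipschitz ℝ hC) ht.le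
      _ < e := htC.trans_le (min_le_left _ _)
  simp only [abs_of_pos hpos, smul_eq_mul, hφ]
  ring

theorem setIntegral_pow_mul_det_eq [MeasurableSpace V] [BorelSpace V] (μ : Measure V)
    [μ.IsAddHaarMeasure] {η : V → V} (hη : ContDiff ℝ 1 η) {R : ℝ}
    (hR : ∀ z, R ≤ ‖z‖ → η z = 0) (M : ℝ) (k : ℕ) :
    ∫ z in closedBall 0 R, (1 - ‖z + η z‖ ^ 2 / M ^ 2) ^ k *
        (ContinuousLinearMap.id ℝ V + fderiv ℝ η z).det ∂μ =
      ∫ z in closedBall 0 R, (1 - ‖z‖ ^ 2 / M ^ 2) ^ k ∂μ := by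
  obtain ⟨t₀, ht₀, h⟩ := exists_pos_forall_setIntegral_det_eq μ hη hR
  obtain ⟨a, v, hv, hav⟩ := exists_nodes_eval_one_eq_sum (2 * k + Module.finrank ℝ V) ht₀
  set F : ℝ → V → ℝ := fun t z => (1 - ‖z + t • η z‖ ^ 2 / M ^ 2) ^ k *
        (ContinuousLinearMap.id ℝ V + t • fderiv ℝ η z).det with hF
  have hη' : Continuous (fderiv ℝ η) := hη.continuous_fderiv one_ne_zero
  have hcont : ∀ t, Continuous (F t) := by
    intro t
    have h1 := hη.continuous
    have h2 : Continuous fun z => (ContinuousLinearMap.id ℝ V + t • fderiv ℝ η z).det :=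
      ContinuousLinearMap.continuous_det.comp (by fun_prop)
    exact Continuous.mul (by fun_prop) h2
  have hint : ∀ t, IntegrableOn (F t) (closedBall 0 R) μ := fun t =>
    (hcont t).continuousOn.integrableOn_compact (isCompact_closedBall _ _)
  have hF1 : ∀ z, F 1 z = ∑ i ∈ Finset.range (2 * k + Module.finrank ℝ V + 1), a i * F (v i) z := by
    intro z
    obtain ⟨p, hp, hpe⟩ := exists_polynomial_eval_eq_pow_mul_det z (η z) (fderiv ℝ η z) M k
    have := hav p hp
    simpa only [hpe] using this
  have ha : ∑ i ∈ Finset.range (2 * k + Module.finrank ℝ V + 1), a i = 1 := by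
    have := hav 1 (by simp)
    simpa using this.symm
  have h1 : ∀ z, (1 - ‖z + η z‖ ^ 2 / M ^ 2) ^ k *
      (ContinuousLinearMap.id ℝ V + fderiv ℝ η z).det = F 1 z := by intro z; simp [hF]
  simp_rw [h1, hF1]
  rw [integral_finsetSum _ fun i _ => (hint (v i)).const_mul (a i)]
  have h2 : ∀ i, ∫ z in closedBall 0 R, a i * F (v i) z ∂μ =
      a i * ∫ z in closedBall 0 R, (1 - ‖z‖ ^ 2 / M ^ 2) ^ k ∂μ := by
    intro i
    rw [integral_const_mul, ← h (v i) (hv i).1 (hv i).2 fun z => (1 - ‖z‖ ^ 2 / M ^ 2) ^ k]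
  simp_rw [h2]
  rw [← Finset.sum_mul, ha, one_mul]

theorem exists_add_eq_zero_of_contDiff {η : V → V} (hη : ContDiff ℝ 1 η) {R : ℝ} (hR0 : 0 < R)
    (hR : ∀ z, R ≤ ‖z‖ → η z = 0) : ∃ z, z + η z = 0 := by
  by_contra! hne
  borelize V
  let μ : Measure V := Measure.addHaar
  have hη0 := hη.continuous
  have hη' : Continuous (fderiv ℝ η) := hη.continuous_fderiv one_ne_zero
  have hcomp := isCompact_closedBall (0 : V) R
  have hneB : (closedBall (0 : V) R).Nonempty := ⟨0, by simp [hR0.le]⟩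
  obtain ⟨z₁, -, hz₁⟩ := hcomp.exists_isMinOn hneB
    (f := fun z => ‖z + η z‖) (by fun_prop)
  obtain ⟨z₂, -, hz₂⟩ := hcomp.exists_isMaxOn hneB
    (f := fun z => ‖z + η z‖) (by fun_prop)
  set c := min ‖z₁ + η z₁‖ R with hc
  set M := max ‖z₂ + η z₂‖ R with hM
  have hc0 : 0 < c := lt_min (norm_pos_iff.2 (hne z₁)) hR0
  have hM0 : 0 < M := hR0.trans_le (le_max_right _ _)
  have hcM : c ≤ M := (min_le_right _ _).trans (le_max_right _ _)
  have hlow : ∀ z ∈ closedBall (0 : V) R, c ≤ ‖z + η z‖ := fun z hz => (min_le_left _ _).trans (hz₁ hz)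
  have hup : ∀ z ∈ closedBall (0 : V) R, ‖z + η z‖ ≤ M := fun z hz => (hz₂ hz).trans (le_max_left _ _)
  set q₁ := 1 - c ^ 2 / M ^ 2 with hq₁
  set q₂ := 1 - (c / 2) ^ 2 / M ^ 2 with hq₂
  have hq₁0 : 0 ≤ q₁ := by
    rw [hq₁, sub_nonneg, div_le_one (by positivity)]
    gcongr
  have hq : q₁ < q₂ := by
    rw [hq₁, hq₂]
    gcongr
    linarith
  have hq₂0 : 0 < q₂ := hq₁0.trans_lt hq
  set D := ∫ z in closedBall 0 R, |(ContinuousLinearMap.id ℝ V + fderiv ℝ η z).det| ∂μ with hD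
  set m := μ.real (closedBall 0 (c / 2)) with hm
  have hm0 : 0 < m := by
    rw [hm, measureReal_def]
    exact ENNReal.toReal_pos (measure_closedBall_pos μ _ (by positivity)).ne'
      measure_closedBall_lt_top.ne
  have hdetc : Continuous fun z => (ContinuousLinearMap.id ℝ V + fderiv ℝ η z).det :=
    ContinuousLinearMap.continuous_det.comp (by fun_prop)
  have key : ∀ k : ℕ, q₂ ^ k * m ≤ q₁ ^ k * D := by
    intro k
    have hup' : ∫ z in closedBall 0 R, (1 - ‖z + η z‖ ^ 2 / M ^ 2) ^ k *
        (ContinuousLinearMap.id ℝ V + fderiv ℝ η z).det ∂μ ≤ q₁ ^ k * D := by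
      rw [hD, ← integral_const_mul]
      refine setIntegral_mono_on ?_ ?_ measurableSet_closedBall fun z hz => ?_
      · refine ContinuousOn.integrableOn_compact hcomp (Continuous.continuousOn ?_)
        exact Continuous.mul (by fun_prop) hdetc
      · refine ContinuousOn.integrableOn_compact hcomp (Continuous.continuousOn ?_)
        exact Continuous.mul (by fun_prop) hdetc.abs
      · have h0 : 0 ≤ 1 - ‖z + η z‖ ^ 2 / M ^ 2 := by
          rw [sub_nonneg, div_le_one (by positivity)]
          gcongr
          exact hup z hz
        have h1 : 1 - ‖z + η z‖ ^ 2 / M ^ 2 ≤ q₁ := by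
          rw [hq₁]
          gcongr
          exact hlow z hz
        calc _ ≤ (1 - ‖z + η z‖ ^ 2 / M ^ 2) ^ k *
              |(ContinuousLinearMap.id ℝ V + fderiv ℝ η z).det| :=
              mul_le_mul_of_nonneg_left (le_abs_self _) (pow_nonneg h0 k)
          _ ≤ _ := mul_le_mul_of_nonneg_right (pow_le_pow_left₀ h0 h1 k) (abs_nonneg _)
    have hw : Continuous fun z : V => (1 - ‖z‖ ^ 2 / M ^ 2) ^ k := by fun_prop
    have hlow' : q₂ ^ k * m ≤ ∫ z in closedBall 0 R, (1 - ‖z‖ ^ 2 / M ^ 2) ^ k ∂μ := by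
      have hsub : closedBall (0 : V) (c / 2) ⊆ closedBall 0 R :=
        closedBall_subset_closedBall (by linarith [min_le_right ‖z₁ + η z₁‖ R])
      have h1 : q₂ ^ k * m = ∫ z in closedBall (0 : V) (c / 2), q₂ ^ k ∂μ := by
        rw [setIntegral_const, smul_eq_mul, mul_comm]
      rw [h1]
      calc _ ≤ ∫ z in closedBall (0 : V) (c / 2), (1 - ‖z‖ ^ 2 / M ^ 2) ^ k ∂μ := by
            refine setIntegral_mono_on ?_ ?_ measurableSet_closedBall fun z hz => ?_
            · exact continuousOn_const.integrableOn_compact (isCompact_closedBall _ _)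
            · exact hw.continuousOn.integrableOn_compact (isCompact_closedBall _ _)
            · refine pow_le_pow_left₀ hq₂0.le ?_ k
              rw [hq₂]
              gcongr
              simpa using hz
        _ ≤ _ := by
            refine setIntegral_mono_set (hw.continuousOn.integrableOn_compact hcomp) ?_
              hsub.eventuallyLE
            refine (ae_restrict_iff' measurableSet_closedBall).2 (ae_of_all _ fun z hz => ?_)
            refine pow_nonneg ?_ k
            rw [sub_nonneg, div_le_one (by positivity)]
            gcongr
            exact (by simpa using hz : ‖z‖ ≤ R).trans (le_max_right _ _)
    exact hlow'.trans ((setIntegral_pow_mul_det_eq μ hη hR M k).symm.le.trans hup')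
  have hlim : Tendsto (fun k : ℕ => (q₁ / q₂) ^ k * D) atTop (𝓝 (0 * D)) :=
    (tendsto_pow_atTop_nhds_zero_of_lt_one (by positivity) ((div_lt_one hq₂0).2 hq)).mul_const D
  rw [zero_mul] at hlim
  refine absurd (ge_of_tendsto' hlim (b := m) fun k => ?_) (not_le.2 hm0)
  rw [div_pow, div_mul_eq_mul_div, le_div_iff₀ (by positivity), mul_comm]
  exact key k

/-- A continuous self-map of a finite-dimensional Euclidean space that is the identity outside a
bounded set has a zero. -/
theorem exists_eq_zero_of_eq_self_of_le_norm {Φ : V → V} (hΦ : Continuous Φ) {R : ℝ}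
    (hR : ∀ z, R ≤ ‖z‖ → Φ z = z) : ∃ z, Φ z = 0 := by
  by_contra! hne
  set S := max R 1 with hS
  have hcomp := isCompact_closedBall (0 : V) S
  have hS0 : 0 < S := zero_lt_one.trans_le (le_max_right _ _)
  have hneB : (closedBall (0 : V) S).Nonempty := ⟨0, by simp [hS0.le]⟩
  obtain ⟨z₁, -, hz₁⟩ := hcomp.exists_isMinOn hneB (f := fun z => ‖Φ z‖) (by fun_prop)
  set c := min ‖Φ z₁‖ S with hc
  have hc0 : 0 < c := lt_min (norm_pos_iff.2 (hne z₁)) hS0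
  have hlow : ∀ z, c ≤ ‖Φ z‖ := by
    intro z
    by_cases hz : ‖z‖ ≤ S
    · exact (min_le_left _ _).trans (hz₁ (by simpa using hz))
    · rw [hR z ((le_max_left _ _).trans (not_le.1 hz).le)]
      exact (min_le_right _ _).trans (not_le.1 hz).le
  have hsupp : HasCompactSupport fun z => Φ z - z := by
    refine HasCompactSupport.intro hcomp fun z hz => ?_
    simp only [mem_closedBall, dist_zero_right, not_le] at hz
    rw [hR z ((le_max_left _ _).trans hz.le), sub_self]
  have hcont : Continuous fun z => Φ z - z := by fun_prop
  obtain ⟨d, hd, hunif⟩ := Metric.uniformContinuous_iff.1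
    (hsupp.uniformContinuous_of_continuous hcont) (c / 2) (by positivity)
  obtain ⟨η, hη, hηd⟩ := hcont.exists_contDiff_dist_le_of_forall_mem_ball_dist_le hd
  have hη0 : ∀ z, S + d ≤ ‖z‖ → η z = 0 := by
    intro z hz
    have hfar : ∀ x ∈ ball z d, Φ x - x = 0 := by
      intro x hx
      rw [hR x, sub_self]
      have := norm_sub_norm_le z x
      rw [mem_ball, dist_comm, dist_eq_norm] at hx
      linarith [le_max_left R 1]
    have := hηd z 0 fun x hx => by simp [hfar x hx, hfar z (mem_ball_self hd)]
    rwa [hfar z (mem_ball_self hd), dist_le_zero] at this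
  obtain ⟨z, hz⟩ := exists_add_eq_zero_of_contDiff (hη.of_le (by exact_mod_cast le_top))
    (by positivity : 0 < S + d) hη0
  have h1 := hηd z (c / 2) fun x hx => (hunif hx).le
  have h2 : η z = -z := by rw [← add_right_inj z, hz, add_neg_cancel]
  rw [h2, dist_eq_norm] at h1
  have h3 : ‖-z - (Φ z - z)‖ = ‖Φ z‖ := by rw [← norm_neg]; congr 1; abel
  linarith [hlow z]

end NoRetraction

/-! ### Separation by the boundary of a bounded open set -/

section Separation

open Metric Set Filter Topology

variable {V : Type*} [NormedAddCommGroup V] [InnerProductSpace ℝ V] [FiniteDimensional ℝ V]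

/-- If `G` is a bounded open set containing `x`, then the map `z ↦ z - x` on the boundary of `G` does
not extend to a nowhere vanishing map on the closure of `G`. -/
theorem exists_mem_closure_eq_zero {G : Set V} (hGb : Bornology.IsBounded G)
    {x : V} (hx : x ∈ G) {Ψ : V → V} (hΨ : Continuous Ψ) (hΨx : ∀ z ∈ frontier G, Ψ z = z - x) :
    ∃ z ∈ closure G, Ψ z = 0 := by
  classical
  by_contra! hne
  set Φ : V → V := fun z => if z ∈ closure G then Ψ z else z - x with hΦ
  have hΦc : Continuous Φ := by
    refine Continuous.if (fun z hz => hΨx z ?_) hΨ (by fun_prop)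
    exact frontier_closure_subset hz
  have hcl : Bornology.IsBounded (closure G) := hGb.closure
  obtain ⟨R, hR⟩ := hcl.subset_closedBall x
  obtain ⟨w, hw⟩ := exists_eq_zero_of_eq_self_of_le_norm (Φ := fun w => Φ (w + x)) (R := R + 1)
    (by fun_prop) fun w hw => by
      have : w + x ∉ closure G := fun h => by
        have := hR h
        rw [mem_closedBall, dist_eq_norm, add_sub_cancel_right] at this
        linarith
      simp [hΦ, this]
  by_cases h : w + x ∈ closure G
  · exact hne _ h (by simpa [hΦ, h] using hw)
  · simp only [hΦ, h, if_false, add_sub_cancel_right] at hw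
    rw [hw, zero_add] at h
    exact h (subset_closure hx)

/-- If `G` is a bounded open set containing `x` but not containing `0` in its closure, there is no
homotopy through nowhere vanishing maps from `z ↦ z` to `z ↦ z - x` on the boundary of `G`. -/
theorem exists_homotopy_eq_zero {G : Set V} (hGb : Bornology.IsBounded G)
    {x : V} (hx : x ∈ G) {H : V × ℝ → V}
    (hH : ContinuousOn H (frontier G ×ˢ Icc (-1) 1 ∪ closure G ×ˢ {-1}))
    (h0 : ∀ z ∈ closure G, H (z, -1) ≠ 0) (h1 : ∀ z ∈ frontier G, H (z, 1) = z - x) :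
    ∃ z ∈ frontier G, ∃ t ∈ Icc (-1 : ℝ) 1, H (z, t) = 0 := by
  by_contra! hne
  set S : Set (V × ℝ) := frontier G ×ˢ Icc (-1) 1 ∪ closure G ×ˢ {-1} with hS
  have hSc : IsClosed S :=
    (isClosed_frontier.prod isClosed_Icc).union (isClosed_closure.prod isClosed_singleton)
  have : TietzeExtension V := TietzeExtension.of_tvs ℝ
  obtain ⟨K, hK⟩ := ContinuousMap.exists_restrict_eq hSc ⟨S.domRestrict H, hH.domRestrict⟩
  have hKH : ∀ q ∈ S, K q = H q := fun q hq => DFunLike.congr_fun hK ⟨q, hq⟩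
  have hcomp : IsCompact (closure G) := hGb.isCompact_closure
  set Z : Set (V × ℝ) := (closure G ×ˢ Icc (-1) 1) ∩ K ⁻¹' {0} with hZ
  have hZc : IsCompact Z := (hcomp.prod isCompact_Icc).inter_right
    (isClosed_singleton.preimage K.continuous)
  have hZ' : IsClosed (Prod.fst '' Z) := (hZc.image continuous_fst).isClosed
  have hdisj : Disjoint (Prod.fst '' Z) (frontier G) := by
    rw [Set.disjoint_left]
    rintro _ ⟨⟨z, t⟩, ⟨⟨-, ht⟩, hzt⟩, rfl⟩ hz
    have : (z, t) ∈ S := Or.inl ⟨hz, ht⟩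
    rw [mem_preimage, mem_singleton_iff, hKH _ this] at hzt
    exact hne z hz t ht hzt
  obtain ⟨u, hu0, hu1, hu⟩ := exists_continuous_zero_one_of_isClosed hZ' isClosed_frontier hdisj
  obtain ⟨z, hz, hz0⟩ := exists_mem_closure_eq_zero hGb hx
    (Ψ := fun z => K (z, 2 * u z - 1)) (by fun_prop) fun z hz => by
      have h2 : (2 : ℝ) * u z - 1 = 1 := by rw [hu1 hz]; norm_num
      have : (z, (1 : ℝ)) ∈ S := Or.inl ⟨hz, by simp⟩
      simp only [h2]
      rw [hKH _ this, h1 z hz]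
  have huz := hu z
  have hmem : (z, 2 * u z - 1) ∈ Z :=
    ⟨⟨hz, ⟨by linarith [huz.1], by linarith [huz.2]⟩⟩, hz0⟩
  have : u z = 0 := hu0 ⟨_, hmem, rfl⟩
  simp only [this, mul_zero, zero_sub] at hz0
  rw [hKH _ (Or.inr ⟨hz, mem_singleton _⟩)] at hz0
  exact h0 z hz hz0

variable {E : Type*} [NormedAddCommGroup E] [NormedSpace ℝ E] [ProperSpace E]

/-- Let `g` embed the closed unit ball with `g 0 = 0`. A bounded open set whose boundary lies in the
union of the image of `g` and of a closed set `Y` far from `0`, and which has a point `x`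
close to `0` off the image of `g`, contains `0` in its closure. -/
theorem zero_mem_closure_of_frontier_subset {g : E → V} (hg : ContinuousOn g (closedBall 0 1))
    (hgi : InjOn g (closedBall 0 1)) (hg0 : g 0 = 0) {δ : ℝ} {Y : Set V} (hY : IsClosed Y)
    (hYδ : ∀ z ∈ Y, δ ≤ ‖z‖) (hgδ : ∀ u, ‖u‖ = 1 → δ ≤ ‖g u‖)
    (hYg : ∀ u ∈ closedBall (0 : E) 1, g u ∈ Y → ‖u‖ = 1)
    {G : Set V} (hGb : Bornology.IsBounded G)
    (hG : frontier G ⊆ Y ∪ g '' closedBall 0 1) {x : V} (hx : x ∈ G) (hxδ : ‖x‖ < δ)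
    (hxg : x ∉ g '' closedBall 0 1) : (0 : V) ∈ closure G := by
  classical
  by_contra h0G
  have h0f : (0 : V) ∉ frontier G := fun h => h0G (frontier_subset_closure h)
  have hBc : IsCompact (closedBall (0 : E) 1) := isCompact_closedBall _ _
  set B := closedBall (0 : E) 1 with hB
  have himc : IsClosed (g '' B) := (hBc.image_of_continuousOn hg).isClosed
  set k : V → E := Function.invFunOn g B with hk
  have hkg : ∀ u ∈ B, k (g u) = u := fun u hu => hgi.leftInvOn_invFunOn hu
  have hkc : ContinuousOn k (g '' B) := by
    rw [continuousOn_iff_isClosed]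
    intro T hT
    refine ⟨g '' (T ∩ B), ((hBc.inter_left hT).image_of_continuousOn
      (hg.mono inter_subset_right)).isClosed, ?_⟩
    ext z
    constructor
    · rintro ⟨hz, u, hu, rfl⟩
      rw [mem_preimage, hkg u hu] at hz
      exact ⟨⟨u, ⟨hz, hu⟩, rfl⟩, ⟨u, hu, rfl⟩⟩
    · rintro ⟨⟨u, ⟨hu, huB⟩, rfl⟩, hz⟩
      exact ⟨by rwa [mem_preimage, hkg u huB], hz⟩
  set m : V × ℝ → ℝ := fun q => max ‖k q.1‖ |q.2| with hm
  set P₁ : Set (V × ℝ) := (frontier G ∩ Y) ×ˢ Icc (-1) 1 ∪ closure G ×ˢ {-1} with hP₁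
  set P₂ : Set (V × ℝ) := (frontier G ∩ g '' B) ×ˢ Icc (-1) 1 with hP₂
  set F₁ : V × ℝ → V := fun q => q.1 - ((1 + q.2) / 2) • x with hF₁
  set F₂ : V × ℝ → V := fun q => g ((m q)⁻¹ • k q.1) - ((1 + q.2 / m q) / 2) • x with hF₂
  have hP₁c : IsClosed P₁ := ((isClosed_frontier.inter hY).prod isClosed_Icc).union
    (isClosed_closure.prod isClosed_singleton)
  have hP₂c : IsClosed P₂ := (isClosed_frontier.inter himc).prod isClosed_Icc
  have hk0 : ∀ u ∈ B, g u ∈ frontier G → u ≠ 0 := by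
    rintro u - hu rfl
    exact h0f (hg0 ▸ hu)
  have hmpos : ∀ q ∈ P₂, 0 < m q := by
    rintro ⟨_, t⟩ ⟨⟨hz, u, hu, rfl⟩, -⟩
    simp only [hm, hkg u hu]
    exact lt_max_of_lt_left (norm_pos_iff.2 (hk0 u hu hz))
  have hunit : ∀ q ∈ P₂, (m q)⁻¹ • k q.1 ∈ B := by
    intro q hq
    rw [hB, mem_closedBall_zero_iff, norm_smul, norm_inv, Real.norm_of_nonneg (hmpos q hq).le,
      inv_mul_le_one₀ (hmpos q hq)]
    exact le_max_left _ _
  have hF₂c : ContinuousOn F₂ P₂ := by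
    have hkc' : ContinuousOn (fun q : V × ℝ => k q.1) P₂ :=
      hkc.comp continuousOn_fst fun q hq => hq.1.2
    have hmc : ContinuousOn m P₂ := hkc'.norm.sup continuousOn_snd.abs
    have hne : ∀ q ∈ P₂, m q ≠ 0 := fun q hq => (hmpos q hq).ne'
    refine ContinuousOn.sub (hg.comp ((hmc.inv₀ hne).smul hkc') hunit) ?_
    exact ((continuousOn_const.add (continuousOn_snd.div hmc hne)).div_const 2).smul
      continuousOn_const
  have hagree : ∀ q ∈ P₁ ∩ P₂, F₂ q = F₁ q := by
    rintro ⟨_, t⟩ ⟨hq₁, ⟨hz, u, hu, rfl⟩, ht⟩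
    have hm1 : m (g u, t) = 1 := by
      have hu1 : ‖u‖ ≤ 1 := by simpa [hB] using hu
      have ht1 : |t| ≤ 1 := abs_le.2 ht
      simp only [hm, hkg u hu]
      rcases hq₁ with ⟨⟨-, hY'⟩, -⟩ | ⟨-, ht'⟩
      · rw [hYg u hu hY', max_eq_left ht1]
      · simp only [mem_singleton_iff] at ht'
        rw [ht', abs_neg, abs_one, max_eq_right hu1]
    simp [hF₁, hF₂, hm1, hkg u hu]
  set H : V × ℝ → V := fun q => if q ∈ P₂ then F₂ q else F₁ q with hH
  have hH₂ : EqOn H F₂ P₂ := fun q hq => by simp [hH, hq]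
  have hH₁ : EqOn H F₁ P₁ := fun q hq => by
    by_cases hq' : q ∈ P₂
    · rw [hH₂ hq', hagree q ⟨hq, hq'⟩]
    · simp [hH, hq']
  have hHc : ContinuousOn H (frontier G ×ˢ Icc (-1) 1 ∪ closure G ×ˢ {-1}) := by
    refine ContinuousOn.mono (ContinuousOn.union_of_isClosed
      ((by fun_prop : Continuous F₁).continuousOn.congr hH₁) (hF₂c.congr hH₂) hP₁c hP₂c) ?_
    rintro ⟨z, t⟩ (⟨hz, ht⟩ | h)
    · rcases hG hz with h | h
      · exact Or.inl (Or.inl ⟨⟨hz, h⟩, ht⟩)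
      · exact Or.inr ⟨⟨hz, h⟩, ht⟩
    · exact Or.inl (Or.inr h)
  obtain ⟨z, hz, t, ht, hzt⟩ := exists_homotopy_eq_zero hGb hx hHc
    (fun z hz => by
      rw [hH₁ (Or.inr ⟨hz, mem_singleton _⟩)]
      simp only [hF₁, add_neg_cancel, zero_div, zero_smul, sub_zero]
      rintro rfl
      exact h0G hz)
    (fun z hz => by
      rcases hG hz with h | ⟨u, hu, rfl⟩
      · rw [hH₁ (Or.inl ⟨⟨hz, h⟩, by simp⟩)]
        norm_num [hF₁]
      · have hm1 : m (g u, 1) = 1 := by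
          simp only [hm, hkg u hu, abs_one]
          exact max_eq_right (by simpa [hB] using hu)
        rw [hH₂ ⟨⟨hz, u, hu, rfl⟩, by simp⟩]
        norm_num [hF₂, hm1, hkg u hu])
  have hsmall : ∀ s : ℝ, |s| ≤ 1 → ∀ w : V, δ ≤ ‖w‖ → w - ((1 + s) / 2) • x ≠ 0 := by
    intro s hs w hw h
    rw [sub_eq_zero] at h
    rw [h, norm_smul, Real.norm_eq_abs, abs_of_nonneg (by linarith [(abs_le.1 hs).1])] at hw
    have : (1 + s) / 2 * ‖x‖ ≤ 1 * ‖x‖ :=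
      mul_le_mul_of_nonneg_right (by linarith [(abs_le.1 hs).2]) (norm_nonneg _)
    linarith
  rcases hG hz with h | ⟨u, hu, rfl⟩
  · rw [hH₁ (Or.inl ⟨⟨hz, h⟩, ht⟩)] at hzt
    exact hsmall t (abs_le.2 ht) z (hYδ z h) hzt
  · have hq : (g u, t) ∈ P₂ := ⟨⟨hz, u, hu, rfl⟩, ht⟩
    have hmp := hmpos _ hq
    have hv := hunit _ hq
    rw [hH₂ hq] at hzt
    simp only [hF₂] at hzt
    set v := (m (g u, t))⁻¹ • k (g u, t).1 with hvdef
    have hts : |t / m (g u, t)| ≤ 1 := by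
      rw [abs_div, abs_of_pos hmp, div_le_one hmp]
      exact le_max_right _ _
    rcases le_total |t| ‖k (g u)‖ with hle | hle
    · refine hsmall _ hts (g v) (hgδ v ?_) hzt
      have hmk : m (g u, t) = ‖k (g u)‖ := max_eq_left hle
      rw [hvdef, norm_smul, norm_inv, Real.norm_of_nonneg hmp.le, hmk]
      exact inv_mul_cancel₀ (hmk ▸ hmp.ne')
    · have hmt : m (g u, t) = |t| := max_eq_right hle
      rcases le_total 0 t with h0 | h0
      · rw [hmt, abs_of_nonneg h0, div_self (by rw [← abs_of_nonneg h0, ← hmt]; exact hmp.ne')] at hzt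
        norm_num [sub_eq_zero] at hzt
        exact hxg ⟨v, hv, hzt⟩
      · have htne : t ≠ 0 := by
          rintro rfl
          rw [hmt, abs_zero] at hmp
          exact lt_irrefl _ hmp
        rw [hmt, abs_of_nonpos h0, div_neg, div_self htne] at hzt
        norm_num at hzt
        have hv0 : v = 0 := hgi hv (by simp [hB]) (hzt.trans hg0.symm)
        rw [hvdef, hkg u hu, smul_eq_zero] at hv0
        exact hv0.elim (inv_ne_zero hmp.ne') (hk0 u hu hz)

end Separation

/-! ### Local components of the complement of the image -/

section LocalComponents

open Metric Set Filter Topology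

variable {V : Type*} [NormedAddCommGroup V] [InnerProductSpace ℝ V] [FiniteDimensional ℝ V]
  {E : Type*} [NormedAddCommGroup E] [NormedSpace ℝ E] [ProperSpace E]
  {N M : Type*} [TopologicalSpace N] [CompactSpace N] [TopologicalSpace M] [T2Space M]
  [LocallyConnectedSpace M]

theorem eventually_mem_closure_connectedComponentIn_diff_range (k : OpenPartialHomeomorph N E)
    (h : OpenPartialHomeomorph M V) {f : N → M} (hf : Continuous f) {p : N} (hp : p ∈ k.source)
    (hfp : f p ∈ h.source) (hinj : ∀ᶠ p' in 𝓝 p, ∀ q, f q = f p' → q = p') {U : Set M}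
    (hU : IsOpen U) (hpU : f p ∈ U) :
    ∀ᶠ x in 𝓝 (f p), x ∉ range f →
      f p ∈ closure (connectedComponentIn (U \ range f) x) := by
  set a := k p with ha
  set b := h (f p) with hb
  set σ : V → M := fun w => h.symm (b + w) with hσ
  have hσ0 : σ 0 = f p := by simp [hσ, hb, h.left_inv hfp]
  have hbt : b ∈ h.target := h.map_source hfp
  have hat : a ∈ k.target := k.map_source hp
  obtain ⟨R, hR, hRsub⟩ : ∃ R > 0, ∀ w ∈ closedBall (0 : V) R, b + w ∈ h.target ∧ σ w ∈ U := by
    have h1 : ∀ᶠ v in 𝓝 b, v ∈ h.target ∧ h.symm v ∈ U :=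
      (h.open_target.eventually_mem hbt).and
        ((h.continuousAt_symm hbt).eventually (by
          rw [h.left_inv hfp]; exact hU.mem_nhds hpU))
    have h2 : Tendsto (fun w : V => b + w) (𝓝 0) (𝓝 b) := by
      have : Continuous fun w : V => b + w := by fun_prop
      simpa only [add_zero] using this.tendsto 0
    obtain ⟨R, hR, hRsub⟩ := nhds_basis_closedBall.mem_iff.1 (h2.eventually h1)
    exact ⟨R, hR, fun w hw => hRsub hw⟩
  have hσc : ContinuousOn σ (closedBall 0 R) :=
    h.continuousOn_symm.comp (by fun_prop) fun w hw => (hRsub w hw).1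
  have hσh : ∀ w ∈ closedBall (0 : V) R, h (σ w) - b = w := fun w hw => by
    rw [hσ, h.right_inv (hRsub w hw).1, add_sub_cancel_left]
  have hhσ : ∀ z ∈ h.source, σ (h z - b) = z := fun z hz => by
    rw [hσ]; simp [h.left_inv hz]
  obtain ⟨ρ, hρ, hρsub⟩ : ∃ ρ > 0, ∀ v ∈ closedBall a ρ, v ∈ k.target ∧
      (∀ q, f q = f (k.symm v) → q = k.symm v) ∧ f (k.symm v) ∈ h.source ∧
        ‖h (f (k.symm v)) - b‖ < R := by
    have h0 : Tendsto k.symm (𝓝 a) (𝓝 p) := by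
      have := k.continuousAt_symm hat
      rwa [ContinuousAt, ha, k.left_inv hp] at this
    have h1 : Tendsto (fun q => ‖h (f q) - b‖) (𝓝 p) (𝓝 0) := by
      have : ContinuousAt (fun q => ‖h (f q) - b‖) p :=
        (((h.continuousAt hfp).comp hf.continuousAt).sub continuousAt_const).norm
      simpa [ContinuousAt, hb] using this
    have h2 : ∀ᶠ v in 𝓝 a, v ∈ k.target ∧
      (∀ q, f q = f (k.symm v) → q = k.symm v) ∧ f (k.symm v) ∈ h.source ∧
        ‖h (f (k.symm v)) - b‖ < R :=
      (k.open_target.eventually_mem hat).and <| (h0.eventually hinj).and <|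
        (h0.eventually (hf.continuousAt.eventually (h.open_source.mem_nhds hfp))).and
          (h0.eventually (h1.eventually (gt_mem_nhds hR)))
    obtain ⟨ρ, hρ, hρsub⟩ := nhds_basis_closedBall.mem_iff.1 h2
    exact ⟨ρ, hρ, fun w hw => hρsub hw⟩
  set τ : E → N := fun u => k.symm (a + ρ • u) with hτ
  have hscale : ∀ u : E, dist (a + ρ • u) a = ρ * ‖u‖ := fun u => by
    rw [dist_eq_norm, add_sub_cancel_left, norm_smul, Real.norm_of_nonneg hρ.le]
  have hball : ∀ u ∈ closedBall (0 : E) 1, a + ρ • u ∈ closedBall a ρ := fun u hu => by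
    rw [mem_closedBall, hscale]
    exact mul_le_of_le_one_right hρ.le (by simpa using hu)
  set g : E → V := fun u => h (f (τ u)) - b with hg
  have hgs : ∀ u ∈ closedBall (0 : E) 1, f (τ u) ∈ h.source := fun u hu =>
    (hρsub _ (hball u hu)).2.2.1
  have hgR : ∀ u ∈ closedBall (0 : E) 1, ‖g u‖ < R := fun u hu => (hρsub _ (hball u hu)).2.2.2
  have hτi : ∀ u ∈ closedBall (0 : E) 1, ∀ q, f q = f (τ u) → q = τ u := fun u hu =>
    (hρsub _ (hball u hu)).2.1
  have hkτ : ∀ u ∈ closedBall (0 : E) 1, k (τ u) = a + ρ • u := fun u hu =>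
    k.right_inv (hρsub _ (hball u hu)).1
  have hσg : ∀ u ∈ closedBall (0 : E) 1, σ (g u) = f (τ u) := fun u hu => hhσ _ (hgs u hu)
  have hτc : ContinuousOn τ (closedBall 0 1) :=
    k.continuousOn_symm.comp (by fun_prop) fun u hu => (hρsub _ (hball u hu)).1
  have hgc : ContinuousOn g (closedBall 0 1) :=
    (h.continuousOn.comp (hf.comp_continuousOn hτc) hgs).sub continuousOn_const
  have hgi : InjOn g (closedBall 0 1) := by
    intro u hu v hv huv
    have h1 := congrArg σ huv
    rw [hσg u hu, hσg v hv] at h1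
    have h2 := congrArg k (hτi v hv _ h1)
    rw [hkτ u hu, hkτ v hv, add_right_inj] at h2
    exact smul_right_injective E hρ.ne' h2
  have hτ0 : τ 0 = p := by simp [hτ, ha, k.left_inv hp]
  have hg0 : g 0 = 0 := by simp [hg, hτ0, hb]
  set W : Set N := k.source ∩ k ⁻¹' ball a ρ with hW
  have hWo : IsOpen W := k.isOpen_inter_preimage isOpen_ball
  have hWτ : ∀ q ∈ W, ∃ u ∈ closedBall (0 : E) 1, τ u = q := by
    rintro q ⟨hq, hqb⟩
    have hu : a + ρ • (ρ⁻¹ • (k q - a)) = k q := by rw [smul_inv_smul₀ hρ.ne', add_sub_cancel]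
    refine ⟨ρ⁻¹ • (k q - a), ?_, by rw [hτ]; simp only [hu]; exact k.left_inv hq⟩
    have h1 := hscale (ρ⁻¹ • (k q - a))
    rw [hu] at h1
    rw [mem_preimage, mem_ball, h1] at hqb
    rw [mem_closedBall_zero_iff]
    nlinarith
  have hτW : ∀ u ∈ closedBall (0 : E) 1, τ u ∉ W ↔ ‖u‖ = 1 := by
    intro u hu
    have hs : τ u ∈ k.source := k.map_target (hρsub _ (hball u hu)).1
    have h1 : ‖u‖ ≤ 1 := by simpa using hu
    rw [hW, mem_inter_iff, mem_preimage, hkτ u hu, mem_ball, hscale]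
    simp only [hs, true_and, not_lt]
    constructor
    · intro h2
      nlinarith
    · intro h2
      rw [h2, mul_one]
  set T : Set M := f '' Wᶜ with hT
  have hTc : IsClosed T := (hWo.isClosed_compl.isCompact.image hf).isClosed
  have hgT : ∀ u ∈ closedBall (0 : E) 1, f (τ u) ∈ T ↔ ‖u‖ = 1 := by
    intro u hu
    rw [← hτW u hu]
    constructor
    · rintro ⟨q, hq, hqu⟩
      rwa [← hτi u hu q hqu]
    · exact fun h1 => ⟨_, h1, rfl⟩
  set Y : Set V := {w | R ≤ ‖w‖} ∪ (closedBall 0 R ∩ σ ⁻¹' T) with hY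
  have hYc : IsClosed Y := (isClosed_le continuous_const continuous_norm).union
    (hσc.preimage_isClosed_of_isClosed isClosed_closedBall hTc)
  have hYg : ∀ u ∈ closedBall (0 : E) 1, g u ∈ Y ↔ ‖u‖ = 1 := by
    intro u hu
    rw [← hgT u hu, hY, mem_union, mem_inter_iff, mem_preimage, hσg u hu]
    have h1 := hgR u hu
    simp [h1.le, not_le.2 h1]
  have h0Y : (0 : V) ∉ Y := by
    have h1 : (0 : E) ∈ closedBall (0 : E) 1 := by simp
    rw [← hg0, hYg 0 h1]
    simp
  obtain ⟨δ, hδ, hδY⟩ := Metric.isOpen_iff.1 hYc.isOpen_compl 0 h0Y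
  have hYδ : ∀ z ∈ Y, δ ≤ ‖z‖ := fun z hz => by
    by_contra hcon
    exact hδY (by simpa using hcon) hz
  have hev : ∀ᶠ x in 𝓝 (f p), x ∈ h.source ∧ x ∈ U ∧ ‖h x - b‖ < min δ R := by
    refine (h.open_source.eventually_mem hfp).and ((hU.eventually_mem hpU).and ?_)
    have h1 : ContinuousAt (fun x => ‖h x - b‖) (f p) :=
      ((h.continuousAt hfp).sub continuousAt_const).norm
    have h2 : Tendsto (fun x => ‖h x - b‖) (𝓝 (f p)) (𝓝 0) := by
      simpa [ContinuousAt, hb] using h1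
    exact h2.eventually (gt_mem_nhds (lt_min hδ hR))
  filter_upwards [hev] with x hx hxf
  obtain ⟨hxs, hxU, hxδ⟩ := hx
  have hOo : IsOpen (U \ range f) := hU.sdiff (isCompact_range hf).isClosed
  set C := connectedComponentIn (U \ range f) x with hC
  have hCo : IsOpen C := hOo.connectedComponentIn
  set G : Set V := ball 0 R ∩ σ ⁻¹' C with hG
  have hσb : ContinuousOn σ (ball 0 R) := hσc.mono ball_subset_closedBall
  have hGo : IsOpen G := hσb.isOpen_inter_preimage isOpen_ball hCo
  have hclos : ∀ w ∈ ball (0 : V) R, w ∈ closure G → σ w ∈ closure C := fun w hw hwG =>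
    ContinuousWithinAt.mem_closure ((hσb w hw).mono inter_subset_left) hwG fun v hv => hv.2
  have hfront : frontier G ⊆ Y ∪ g '' closedBall 0 1 := by
    intro w hw
    by_cases hwR : R ≤ ‖w‖
    · exact Or.inl (Or.inl hwR)
    have hwb : w ∈ ball (0 : V) R := by simpa using hwR
    have hwb' := ball_subset_closedBall hwb
    have hwC := hclos w hwb (frontier_subset_closure hw)
    have hwr : σ w ∈ range f := by
      by_contra hcon
      have hmem : σ w ∈ U \ range f := ⟨(hRsub w hwb').2, hcon⟩
      obtain ⟨v, hv1, hv2⟩ := mem_closure_iff.1 hwC _ hOo.connectedComponentIn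
        (mem_connectedComponentIn hmem)
      have h1 := (connectedComponentIn_eq hv1).trans (connectedComponentIn_eq hv2).symm
      have h2 : w ∈ G := ⟨hwb, by
        rw [mem_preimage, hC, ← h1]; exact mem_connectedComponentIn hmem⟩
      rw [hGo.frontier_eq] at hw
      exact hw.2 h2
    obtain ⟨q, hq⟩ := hwr
    by_cases hqW : q ∈ W
    · obtain ⟨u, hu, rfl⟩ := hWτ q hqW
      refine Or.inr ⟨u, hu, ?_⟩
      rw [hg, ← hσh w hwb', ← hq]
    · exact Or.inl (Or.inr ⟨hwb', q, hqW, hq⟩)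
  have h0G : (0 : V) ∈ closure G := by
    refine zero_mem_closure_of_frontier_subset hgc hgi hg0 hYc hYδ
      (fun u hu => hYδ _ ((hYg u (by simp [hu])).2 hu)) (fun u hu => (hYg u hu).1)
      (isBounded_ball.subset inter_subset_left) hfront (x := h x - b) ⟨?_, ?_⟩
      (hxδ.trans_le (min_le_left _ _)) ?_
    · simpa using hxδ.trans_le (min_le_right _ _)
    · rw [mem_preimage, hhσ x hxs]
      exact mem_connectedComponentIn ⟨hxU, hxf⟩
    · rintro ⟨u, hu, hux⟩
      have := congrArg σ hux
      rw [hσg u hu, hhσ x hxs] at this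
      exact hxf ⟨_, this⟩
  rw [← hσ0]
  exact hclos 0 (by simpa using hR) h0G

end LocalComponents

/-- Let `n ≥ 1` and let `f : Sⁿ → Sⁿ⁺¹` be a continuous map whose set of
injectivity contains the closed metric ball `D` of radius `0 < r < 1` about `x₀ ∈ Sⁿ`, and
let `U₁, U₂` be the two connected components of `Sⁿ⁺¹ \ f(Sⁿ)` whose closures intersect
`f(D°)`.  Then for every `p ∈ D°` and every `ε > 0` there exists `0 < δ ≤ ε` such that
`B(f(p), δ) \ f(Sⁿ)` is contained in the union of the two connected components of
`B(f(p), ε) \ f(Sⁿ)` which contain `f(p)` in their closure. -/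
theorem small_ball_complement_subset_two_local_components
    (n : ℕ) (hn : 1 ≤ n)
    (f : (Metric.sphere (0 : EuclideanSpace ℝ (Fin (n + 1))) 1) →
         (Metric.sphere (0 : EuclideanSpace ℝ (Fin (n + 2))) 1))
    (hf : Continuous f)
    (x₀ : Metric.sphere (0 : EuclideanSpace ℝ (Fin (n + 1))) 1)
    (r : ℝ) (hr0 : 0 < r) (hr1 : r < 1)
    (hinj : ∀ p, dist p x₀ ≤ r → ∀ q, f q = f p → q = p)
    (U₁ U₂ : Set (Metric.sphere (0 : EuclideanSpace ℝ (Fin (n + 2))) 1))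
    (hU₁ : IsConnCompIn (Set.range f)ᶜ U₁)
    (hU₂ : IsConnCompIn (Set.range f)ᶜ U₂)
    (hU₁cl : (closure U₁ ∩ f '' {x | dist x x₀ < r}).Nonempty)
    (hU₂cl : (closure U₂ ∩ f '' {x | dist x x₀ < r}).Nonempty)
    (hne : U₁ ≠ U₂)
    (p : Metric.sphere (0 : EuclideanSpace ℝ (Fin (n + 1))) 1)
    (hp : dist p x₀ < r)
    (ε : ℝ) (hε : 0 < ε) :
    ∃ δ : ℝ, 0 < δ ∧ δ ≤ ε ∧
      Metric.ball (f p) δ \ Set.range f ⊆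
        ⋃₀ {C | IsConnCompIn (Metric.ball (f p) ε \ Set.range f) C ∧ f p ∈ closure C} := by
  have : Fact (Module.finrank ℝ (EuclideanSpace ℝ (Fin (n + 1))) = n + 1) := ⟨by simp⟩
  have : Fact (Module.finrank ℝ (EuclideanSpace ℝ (Fin (n + 2))) = (n + 1) + 1) := ⟨by simp⟩
  have : LocallyConnectedSpace (Metric.sphere (0 : EuclideanSpace ℝ (Fin (n + 2))) 1) :=
    ChartedSpace.locallyConnectedSpace (EuclideanSpace ℝ (Fin (n + 1))) _
  have hev := eventually_mem_closure_connectedComponentIn_diff_range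
    (chartAt (EuclideanSpace ℝ (Fin n)) p) (chartAt (EuclideanSpace ℝ (Fin (n + 1))) (f p)) hf
    (mem_chart_source _ p) (mem_chart_source _ (f p))
    (by
      filter_upwards [Metric.isOpen_ball.mem_nhds (Metric.mem_ball.2 hp)] with p' hp'
      exact hinj p' (Metric.mem_ball.1 hp').le)
    Metric.isOpen_ball (Metric.mem_ball_self hε)
  obtain ⟨δ, hδ, hδsub⟩ := Metric.eventually_nhds_iff.1 hev
  refine ⟨min δ ε, lt_min hδ hε, min_le_right _ _, fun x hx => ?_⟩
  have hx' := Metric.mem_ball.1 hx.1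
  have hxε : x ∈ Metric.ball (f p) ε \ Set.range f := ⟨hx'.trans_le (min_le_right _ _), hx.2⟩
  exact ⟨_, ⟨⟨x, hxε, rfl⟩, hδsub (hx'.trans_le (min_le_left _ _)) hx.2⟩,
    mem_connectedComponentIn hxε⟩
end

section
/- Let n ≥ 1 and let f : S^n → S^{n+1} be a continuous map whose set of injectivity I contains the closed metric ball D := {x ∈ S^n : |x − x₀| ≤ r} for some x₀ ∈ S^n and 0 < r < 1, and let U₁, U₂ be the two connected components of S^{n+1} \ f(S^n) whose closures intersect f(D°). Then for every p ∈ D°: (i) for every ε > 0, the open ball B(f(p), ε) in S^{n+1} intersects both U₁ and U₂; and (ii) there exists ε > 0 such that B(f(p), ε) \ f(S^n) ⊆ U₁ ∪ U₂. -/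
section Degree

open Set Filter Topology MeasureTheory Metric

section Jacobian

variable {E : Type*} [NormedAddCommGroup E] [InnerProductSpace ℝ E]

/-- The Jacobian determinant of `u` at `x`. -/
noncomputable def jac (u : E → E) (x : E) : ℝ := (fderiv ℝ u x).det

lemma jac_congr {u v : E → E} {x : E} (h : u =ᶠ[𝓝 x] v) : jac u x = jac v x := by
  simp only [jac, h.fderiv_eq]

lemma jac_comp {u v : E → E} (hu : ContDiff ℝ 1 u) (hv : ContDiff ℝ 1 v) (x : E) :
    jac (u ∘ v) x = jac u (v x) * jac v x := by
  have h : fderiv ℝ (u ∘ v) x = (fderiv ℝ u (v x)).comp (fderiv ℝ v x) :=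
    fderiv_comp x (hu.differentiable one_ne_zero _) (hv.differentiable one_ne_zero _)
  simp only [jac, h]
  exact LinearMap.det_comp _ _

lemma continuous_jac {u : E → E} (hu : ContDiff ℝ 1 u) : Continuous (jac u) :=
  ContinuousLinearMap.continuous_det.comp (hu.continuous_fderiv one_ne_zero)

variable [FiniteDimensional ℝ E]

lemma jac_const [Nontrivial E] (c x : E) : jac (fun _ ↦ c) x = 0 := by
  simp only [jac, fderiv_fun_const, Pi.zero_apply, ContinuousLinearMap.det,
    ContinuousLinearMap.toLinearMap_zero]
  exact LinearMap.det_zero'' (R := ℝ) (M := E)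

/-- A smooth cutoff equal to `1` near a closed set and to `0` off an open neighbourhood. -/
lemma exists_smooth_cutoff {K U : Set E} (hK : IsClosed K) (hU : IsOpen U) (hKU : K ⊆ U) :
    ∃ κ : E → ℝ, ContDiff ℝ 1 κ ∧ (∀ x, κ x ∈ Icc (0 : ℝ) 1) ∧
      (∀ x ∈ K, κ =ᶠ[𝓝 x] fun _ ↦ 1) ∧ ∀ x ∉ U, κ =ᶠ[𝓝 x] fun _ ↦ 0 := by
  obtain ⟨κ, h0, h1, hκ⟩ := exists_contMDiffMap_zero_one_nhds_of_isClosed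
    (n := 1) (modelWithCornersSelf ℝ E)
    hU.isClosed_compl hK (disjoint_compl_left_iff_subset.2 hKU)
  refine ⟨κ, κ.contMDiff.contDiff, hκ, fun x hx ↦ ?_, fun x hx ↦ ?_⟩
  · exact (eventually_nhdsSet_iff_forall.1 h1) x hx
  · exact (eventually_nhdsSet_iff_forall.1 h0) x hx

lemma det_one_add_pos {M : E →L[ℝ] E} (hM : ‖M‖ < 1) : 0 < (1 + M).det := by
  have hc : Continuous fun t : ℝ ↦ (1 + t • M).det :=
    ContinuousLinearMap.continuous_det.comp (by fun_prop)
  have hne : ∀ t ∈ Icc (0 : ℝ) 1, (1 + t • M).det ≠ 0 := by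
    intro t ht
    have hlt : ‖-(t • M)‖ < 1 := by
      rw [norm_neg, norm_smul, Real.norm_of_nonneg ht.1]
      nlinarith [norm_nonneg M, ht.2]
    have hu : IsUnit (1 + t • M) := by
      have := isUnit_one_sub_of_norm_lt_one hlt
      rwa [sub_neg_eq_add] at this
    have h2 : IsUnit ((1 + t • M : E →L[ℝ] E) : E →ₗ[ℝ] E) :=
      hu.map (ContinuousLinearMap.toLinearMapRingHom : (E →L[ℝ] E) →+* (E →ₗ[ℝ] E))
    exact (h2.map (LinearMap.det : (E →ₗ[ℝ] E) →* ℝ)).ne_zero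
  by_contra! hneg
  have h01 : (0 : ℝ) ∈ Icc ((1 + (1:ℝ) • M).det) ((1 + (0:ℝ) • M).det) := by
    refine ⟨by simpa using hneg, ?_⟩
    simp [ContinuousLinearMap.det]
  obtain ⟨t, ht, h⟩ := intermediate_value_Icc' zero_le_one hc.continuousOn h01
  exact hne t ht h

variable [MeasurableSpace E] [BorelSpace E]

lemma setIntegral_det_one_add_smul {u : E → E} (hu : ContDiff ℝ 1 u) {C : NNReal}
    (hC : LipschitzWith C u) {R : ℝ} (hR : ∀ x, x ∉ ball (0 : E) R → u x = 0) {s : ℝ}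
    (hs0 : 0 ≤ s) (hs : s * C < 1) :
    ∫ x in ball (0 : E) R, (1 + s • fderiv ℝ u x).det = volume.real (ball (0 : E) R) := by
  rcases subsingleton_or_nontrivial E with hE | hE
  · have h : ∀ x : E, (1 + s • fderiv ℝ u x).det = 1 := fun x ↦ by
      rw [Subsingleton.elim (1 + s • fderiv ℝ u x) 1]
      simp [ContinuousLinearMap.det]
    simp [h]
  set U : E → E := fun x ↦ x + s • u x with hUdef
  have hUd : ∀ x, HasFDerivAt U (1 + s • fderiv ℝ u x) x := fun x ↦
    (hasFDerivAt_id x).add (((hu.differentiable one_ne_zero x).hasFDerivAt).const_smul s)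
  have happ : ApproximatesLinearOn U
      ((ContinuousLinearEquiv.refl ℝ E : E ≃L[ℝ] E) : E →L[ℝ] E) univ (s.toNNReal * C) := by
    intro x _ y _
    have h := hC.dist_le_mul x y
    rw [dist_eq_norm, dist_eq_norm] at h
    have e : U x - U y - ((ContinuousLinearEquiv.refl ℝ E : E ≃L[ℝ] E) : E →L[ℝ] E) (x - y)
        = s • (u x - u y) := by
      simp only [hUdef, ContinuousLinearEquiv.coe_coe, ContinuousLinearEquiv.refl_apply, smul_sub]
      abel
    rw [e, norm_smul, Real.norm_of_nonneg hs0, NNReal.coe_mul, Real.coe_toNNReal _ hs0, mul_assoc]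
    exact mul_le_mul_of_nonneg_left h hs0
  have hc : Subsingleton E ∨ s.toNNReal * C <
      ‖((ContinuousLinearEquiv.refl ℝ E : E ≃L[ℝ] E).symm : E →L[ℝ] E)‖₊⁻¹ := by
    right
    have : ((ContinuousLinearEquiv.refl ℝ E : E ≃L[ℝ] E).symm : E →L[ℝ] E) =
      ContinuousLinearMap.id ℝ E := rfl
    rw [this, ContinuousLinearMap.nnnorm_id, inv_one, ← NNReal.coe_lt_coe, NNReal.coe_mul,
      Real.coe_toNNReal _ hs0]
    exact hs
  have hinj : Function.Injective U := injOn_univ.1 (happ.injOn hc)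
  have hsurj : Function.Surjective U := happ.surjective hc
  have hfix : ∀ x, x ∉ ball (0 : E) R → U x = x := fun x hx ↦ by simp [hUdef, hR x hx]
  have himg : U '' ball (0 : E) R = ball (0 : E) R := by
    ext y
    constructor
    · rintro ⟨x, hx, rfl⟩
      by_contra hy
      exact hy ((hinj (hfix _ hy)).symm ▸ hx)
    · intro hy
      obtain ⟨x, rfl⟩ := hsurj y
      refine ⟨x, ?_, rfl⟩
      by_contra hx
      exact hx ((hfix x hx) ▸ hy)
  have key := integral_image_eq_integral_abs_det_fderiv_smul volume
    (measurableSet_ball (x := (0 : E)) (ε := R)) (fun x _ ↦ (hUd x).hasFDerivWithinAt)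
    hinj.injOn (fun _ ↦ (1 : ℝ))
  rw [himg] at key
  simp only [integral_const, smul_eq_mul, mul_one, MeasurableSet.univ, measureReal_restrict_apply,
    univ_inter] at key
  rw [key]
  refine setIntegral_congr_fun measurableSet_ball fun x _ ↦ ?_
  refine (abs_of_pos (det_one_add_pos ?_)).symm
  rw [norm_smul, Real.norm_of_nonneg hs0]
  refine lt_of_le_of_lt (mul_le_mul_of_nonneg_left ?_ hs0) hs
  exact norm_fderiv_le_of_lipschitz ℝ hC

open Polynomial in
/-- The Jacobian of a compactly supported `C¹` map integrates to zero. -/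
lemma integral_jac_eq_zero [Nontrivial E] {u : E → E} (hu : ContDiff ℝ 1 u)
    (hs : HasCompactSupport u) : ∫ x, jac u x = 0 := by
  obtain ⟨C, hC⟩ := ContDiff.lipschitzWith_of_hasCompactSupport hs hu one_ne_zero
  obtain ⟨R, hR⟩ := hs.isCompact.isBounded.subset_ball (0 : E)
  have hR' : ∀ x, x ∉ ball (0 : E) R → u x = 0 := fun x hx ↦
    image_eq_zero_of_notMem_tsupport fun h ↦ hx (hR h)
  set d := Module.finrank ℝ E with hd
  have hdpos : 0 < d := Module.finrank_pos
  have hlarge : ∀ l : ℝ, (C : ℝ) < l →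
      ∫ x in ball (0 : E) R, (l • (1 : E →L[ℝ] E) + fderiv ℝ u x).det
        = l ^ d * volume.real (ball (0 : E) R) := by
    intro l hl
    have hl0 : 0 < l := C.coe_nonneg.trans_lt hl
    rw [← setIntegral_det_one_add_smul hu hC hR' (inv_nonneg.2 hl0.le)
      (by rwa [inv_mul_lt_iff₀ hl0, mul_one]), ← integral_const_mul]
    refine setIntegral_congr_fun measurableSet_ball fun x _ ↦ ?_
    have : l • (1 : E →L[ℝ] E) + fderiv ℝ u x = l • (1 + l⁻¹ • fderiv ℝ u x) := by
      rw [smul_add, smul_smul, mul_inv_cancel₀ hl0.ne', one_smul]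
    simp only [this, ContinuousLinearMap.det, ContinuousLinearMap.toLinearMap_smul,
      LinearMap.det_smul, hd]
  let v : ℕ → ℝ := fun i ↦ C + 1 + i
  let S := Finset.range (d + 1)
  have hv : Set.InjOn v S := fun i _ j _ h ↦ by simpa [v] using h
  let c : ℕ → ℝ := fun i ↦ (Lagrange.basis S v i).eval 0
  have hinterp : ∀ p : ℝ[X], p.degree < S.card → p.eval 0 = ∑ i ∈ S, c i * p.eval (v i) := by
    intro p hp
    conv_lhs => rw [Lagrange.eq_interpolate hv hp, Lagrange.interpolate_apply, eval_finsetSum]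
    simp [c, mul_comm]
  have hdet : ∀ M : E →L[ℝ] E, M.det = ∑ i ∈ S, c i * (v i • (1 : E →L[ℝ] E) + M).det := by
    intro M
    have h := hinterp (LinearMap.charpoly (-(M : E →ₗ[ℝ] E))) (by
      rw [degree_eq_natDegree (LinearMap.charpoly_monic _).ne_zero, LinearMap.charpoly_natDegree]
      simp only [S, Finset.card_range, d]
      exact_mod_cast Nat.lt_succ_self _)
    simp only [LinearMap.eval_charpoly, sub_neg_eq_add, map_zero, zero_add] at h
    simpa [ContinuousLinearMap.det, Algebra.algebraMap_eq_smul_one] using h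
  have hX := hinterp ((X : ℝ[X]) ^ d) (by simp [S]; exact_mod_cast Nat.lt_succ_self d)
  simp only [eval_pow, eval_X, zero_pow hdpos.ne'] at hX
  have hball : ∫ x, jac u x = ∫ x in ball (0 : E) R, jac u x := by
    refine (setIntegral_eq_integral_of_forall_compl_eq_zero fun x hx ↦ ?_).symm
    rw [← jac_const (0 : E) x]
    refine jac_congr (notMem_tsupport_iff_eventuallyEq.1 fun h ↦ hx (hR h))
  rw [hball]
  simp only [jac]
  simp_rw [fun x ↦ hdet (fderiv ℝ u x)]
  rw [integral_finsetSum]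
  · simp_rw [integral_const_mul]
    rw [Finset.sum_congr rfl fun i _ ↦ by rw [hlarge (v i) (by simp only [v]; have := i.cast_nonneg (α := ℝ); linarith)]]
    simp_rw [← mul_assoc, ← Finset.sum_mul, ← hX, zero_mul]
  · intro i _
    refine Integrable.const_mul ?_ _
    have hcont : Continuous fun x ↦ (v i • (1 : E →L[ℝ] E) + fderiv ℝ u x).det :=
      ContinuousLinearMap.continuous_det.comp
        (continuous_const.add (hu.continuous_fderiv one_ne_zero))
    exact (hcont.continuousOn.integrableOn_compact (isCompact_closedBall (0 : E) R)).mono_set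
      ball_subset_closedBall

end Jacobian

section JacobianIntegral

variable {E : Type*} [NormedAddCommGroup E] [InnerProductSpace ℝ E] [FiniteDimensional ℝ E]
  [Nontrivial E] [MeasurableSpace E] [BorelSpace E]

omit [MeasurableSpace E] [BorelSpace E] in
lemma HasCompactSupport.jac {u : E → E} (hs : HasCompactSupport u) :
    HasCompactSupport (jac u) := by
  refine HasCompactSupport.intro hs fun x hx ↦ ?_
  rw [← jac_const (0 : E) x]
  exact jac_congr (notMem_tsupport_iff_eventuallyEq.1 hx)

lemma integrableOn_jac {u : E → E} (hu : ContDiff ℝ 1 u) {A : Set E}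
    (hA : Bornology.IsBounded A) : IntegrableOn (jac u) A :=
  ((continuous_jac hu).continuousOn.integrableOn_compact hA.isCompact_closure).mono_set
    subset_closure

lemma integral_jac_sub_jac_eq_zero {u v : E → E} (hu : ContDiff ℝ 1 u) (hv : ContDiff ℝ 1 v)
    (hs : HasCompactSupport (u - v)) : ∫ x, (jac u x - jac v x) = 0 := by
  obtain ⟨R, hR⟩ := hs.isCompact.isBounded.subset_ball (0 : E)
  obtain ⟨κ, hκ, -, h1, h0⟩ := exists_smooth_cutoff (isClosed_tsupport (u - v)) isOpen_ball hR
  have hcs : ∀ w : E → E, HasCompactSupport fun x ↦ κ x • w x := fun w ↦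
    HasCompactSupport.intro (isCompact_closedBall (0 : E) R) fun x hx ↦ by
      rw [(h0 x fun h ↦ hx (ball_subset_closedBall h)).eq_of_nhds, zero_smul]
  have hcd : ∀ w : E → E, ContDiff ℝ 1 w → ContDiff ℝ 1 fun x ↦ κ x • w x := fun w hw ↦
    hκ.smul hw
  have hpt : ∀ x, jac u x - jac v x = jac (fun x ↦ κ x • u x) x - jac (fun x ↦ κ x • v x) x := by
    intro x
    by_cases hx : x ∈ tsupport (u - v)
    · have h : ∀ w : E → E, (fun x ↦ κ x • w x) =ᶠ[𝓝 x] w := fun w ↦ by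
        filter_upwards [h1 x hx] with y hy
        rw [hy, one_smul]
      rw [jac_congr (h u), jac_congr (h v)]
    · have h : u =ᶠ[𝓝 x] v := by
        filter_upwards [notMem_tsupport_iff_eventuallyEq.1 hx] with y hy
        exact sub_eq_zero.1 hy
      have h' : (fun x ↦ κ x • u x) =ᶠ[𝓝 x] fun x ↦ κ x • v x := by
        filter_upwards [h] with y hy
        rw [hy]
      rw [jac_congr h, jac_congr h', sub_self, sub_self]
  have hintgr : ∀ w : E → E, ContDiff ℝ 1 w → Integrable (jac fun x ↦ κ x • w x) := fun w hw ↦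
    (continuous_jac (hcd w hw)).integrable_of_hasCompactSupport (hcs w).jac
  simp_rw [hpt]
  rw [integral_sub (hintgr u hu) (hintgr v hv), integral_jac_eq_zero (hcd u hu) (hcs u),
    integral_jac_eq_zero (hcd v hv) (hcs v), sub_zero]

/-- The integral of the Jacobian over a bounded open set depends only on the germ of the map
along the frontier. -/
lemma setIntegral_jac_congr_frontier {A : Set E} (hA : IsOpen A) (hb : Bornology.IsBounded A)
    {α β : E → E} (hα : ContDiff ℝ 1 α) (hβ : ContDiff ℝ 1 β)
    (h : ∀ x ∈ frontier A, α =ᶠ[𝓝 x] β) : ∫ x in A, jac α x = ∫ x in A, jac β x := by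
  classical
  set γ : E → E := fun x ↦ if x ∈ A then α x else β x with hγdef
  have hγA : ∀ x ∈ A, γ =ᶠ[𝓝 x] α := fun x hx ↦ by
    filter_upwards [hA.mem_nhds hx] with y hy
    simp [hγdef, hy]
  have hγA' : ∀ x ∉ A, γ =ᶠ[𝓝 x] β := fun x hx ↦ by
    by_cases hx' : x ∈ closure A
    · filter_upwards [h x ⟨hx', fun h ↦ hx (interior_subset h)⟩] with y hy
      simp [hγdef, hy]
    · filter_upwards [isClosed_closure.isOpen_compl.mem_nhds hx'] with y hy
      have : y ∉ A := fun h ↦ hy (subset_closure h)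
      simp [hγdef, this]
  have hγ : ContDiff ℝ 1 γ := by
    rw [contDiff_iff_contDiffAt]
    intro x
    by_cases hx : x ∈ A
    · exact hα.contDiffAt.congr_of_eventuallyEq (hγA x hx)
    · exact hβ.contDiffAt.congr_of_eventuallyEq (hγA' x hx)
  have hs : HasCompactSupport (γ - β) := by
    refine HasCompactSupport.intro hb.isCompact_closure fun x hx ↦ ?_
    rw [Pi.sub_apply, (hγA' x fun h ↦ hx (subset_closure h)).eq_of_nhds, sub_self]
  have key := integral_jac_sub_jac_eq_zero hγ hβ hs
  rw [← setIntegral_eq_integral_of_forall_compl_eq_zero (s := A) fun x hx ↦ by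
    rw [jac_congr (hγA' x hx), sub_self]] at key
  rw [integral_sub (integrableOn_jac hγ hb) (integrableOn_jac hβ hb), sub_eq_zero] at key
  rw [← key]
  exact setIntegral_congr_fun hA.measurableSet fun x hx ↦ (jac_congr (hγA x hx)).symm

lemma setIntegral_jac_sub_jac_congr_frontier {A : Set E} (hA : IsOpen A)
    (hb : Bornology.IsBounded A) {α₀ α₁ β₀ β₁ : E → E} (hα₀ : ContDiff ℝ 1 α₀)
    (hα₁ : ContDiff ℝ 1 α₁) (hβ₀ : ContDiff ℝ 1 β₀) (hβ₁ : ContDiff ℝ 1 β₁)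
    (h : ∀ x ∈ frontier A, (α₁ =ᶠ[𝓝 x] α₀ ∧ β₁ =ᶠ[𝓝 x] β₀) ∨ (α₁ =ᶠ[𝓝 x] β₁ ∧ α₀ =ᶠ[𝓝 x] β₀)) :
    ∫ x in A, (jac α₁ x - jac α₀ x) = ∫ x in A, (jac β₁ x - jac β₀ x) := by
  have hopen : ∀ a b c d : E → E, IsOpen {x | a =ᶠ[𝓝 x] b ∧ c =ᶠ[𝓝 x] d} := fun a b c d ↦
    isOpen_setOfPred_eventually_nhds.inter isOpen_setOfPred_eventually_nhds
  set Y := {x | α₁ =ᶠ[𝓝 x] α₀ ∧ β₁ =ᶠ[𝓝 x] β₀} with hY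
  set Y₂ := {x | α₁ =ᶠ[𝓝 x] β₁ ∧ α₀ =ᶠ[𝓝 x] β₀} with hY₂
  obtain ⟨κ, hκ, -, h1, h0⟩ := exists_smooth_cutoff (isClosed_frontier.sdiff (hopen α₁ β₁ α₀ β₀))
    (hopen α₁ α₀ β₁ β₀) fun x hx ↦ (h x hx.1).resolve_right hx.2
  have hcd : ∀ w : E → E, ContDiff ℝ 1 w → ContDiff ℝ 1 fun x ↦ (1 - κ x) • w x := fun w hw ↦
    (contDiff_const.sub hκ).smul hw
  have hsm : ∀ {x} {a b : E → E}, a =ᶠ[𝓝 x] b →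
      (fun x ↦ (1 - κ x) • a x) =ᶠ[𝓝 x] fun x ↦ (1 - κ x) • b x := fun {x a b} hab ↦ by
    filter_upwards [hab] with y hy
    rw [hy]
  have hfr : ∀ a b : E → E, ContDiff ℝ 1 a → ContDiff ℝ 1 b → (∀ x ∈ Y₂, a =ᶠ[𝓝 x] b) →
      ∫ x in A, jac (fun x ↦ (1 - κ x) • a x) x = ∫ x in A, jac (fun x ↦ (1 - κ x) • b x) x := by
    intro a b ha hb' hab
    refine setIntegral_jac_congr_frontier hA hb (hcd a ha) (hcd b hb') fun x hx ↦ ?_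
    by_cases hx2 : x ∈ Y₂
    · exact hsm (hab x hx2)
    · filter_upwards [h1 x ⟨hx, hx2⟩] with y hy
      simp [hy]
  have hpt : ∀ a b : E → E, (∀ x ∈ Y, a =ᶠ[𝓝 x] b) → ∀ x, jac a x - jac b x =
      jac (fun x ↦ (1 - κ x) • a x) x - jac (fun x ↦ (1 - κ x) • b x) x := by
    intro a b hab x
    by_cases hx : x ∈ Y
    · rw [jac_congr (hab x hx), jac_congr (hsm (hab x hx)), sub_self, sub_self]
    · have h : ∀ w : E → E, (fun x ↦ (1 - κ x) • w x) =ᶠ[𝓝 x] w := fun w ↦ by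
        filter_upwards [h0 x hx] with y hy
        rw [hy, sub_zero, one_smul]
      rw [jac_congr (h a), jac_congr (h b)]
  have hintgr : ∀ w : E → E, ContDiff ℝ 1 w → IntegrableOn (jac fun x ↦ (1 - κ x) • w x) A :=
    fun w hw ↦ integrableOn_jac (hcd w hw) hb
  simp_rw [hpt α₁ α₀ fun x hx ↦ hx.1, hpt β₁ β₀ fun x hx ↦ hx.2]
  rw [integral_sub (hintgr _ hα₁) (hintgr _ hα₀), integral_sub (hintgr _ hβ₁) (hintgr _ hβ₀),
    hfr α₁ β₁ hα₁ hβ₁ fun x hx ↦ hx.1, hfr α₀ β₀ hα₀ hβ₀ fun x hx ↦ hx.2]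

end JacobianIntegral

section Bump

variable {E : Type*} [NormedAddCommGroup E] [InnerProductSpace ℝ E]

lemma jac_sum_smul_basis {ι : Type*} [Fintype ι] (b : OrthonormalBasis ι ℝ E) {g : ℝ → ℝ}
    (hg : ContDiff ℝ 1 g) (x : E) :
    jac (fun x ↦ ∑ i, g (inner ℝ (b i) x) • b i) x = ∏ i, deriv g (inner ℝ (b i) x) := by
  classical
  have hd : HasFDerivAt (fun x ↦ ∑ i, g (inner ℝ (b i) x) • b i)
      (∑ i, (deriv g (inner ℝ (b i) x) • innerSL ℝ (b i)).smulRight (b i)) x := by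
    refine HasFDerivAt.fun_sum fun i _ ↦ ?_
    have h1 : HasFDerivAt (fun x ↦ g (inner ℝ (b i) x))
        (deriv g (inner ℝ (b i) x) • innerSL ℝ (b i)) x :=
      ((hg.differentiable one_ne_zero _).hasDerivAt).comp_hasFDerivAt x
        (innerSL ℝ (b i)).hasFDerivAt
    exact h1.smul_const (b i)
  rw [jac, hd.fderiv, ContinuousLinearMap.det, ← LinearMap.det_toMatrix b.toBasis]
  have : LinearMap.toMatrix b.toBasis b.toBasis
      ((∑ i, (deriv g (inner ℝ (b i) x) • innerSL ℝ (b i)).smulRight (b i) : E →L[ℝ] E) :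
        E →ₗ[ℝ] E) = Matrix.diagonal fun i ↦ deriv g (inner ℝ (b i) x) := by
    ext i j
    simp only [LinearMap.toMatrix_apply, OrthonormalBasis.coe_toBasis,
      OrthonormalBasis.coe_toBasis_repr_apply, OrthonormalBasis.repr_apply_apply]
    simp [inner_smul_right, OrthonormalBasis.inner_eq_ite, Matrix.diagonal_apply]
    grind
  rw [this, Matrix.det_diagonal]

variable [FiniteDimensional ℝ E] [Nontrivial E] [MeasurableSpace E] [BorelSpace E]

/-- There are `C¹` maps whose Jacobian is a nonnegative bump supported in a small ball. -/
lemma exists_jac_bump {δ : ℝ} (hδ : 0 < δ) : ∃ Φ : E → E, ContDiff ℝ 1 Φ ∧ (∀ x, 0 ≤ jac Φ x) ∧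
    (∀ x, δ ≤ ‖x‖ → jac Φ x = 0) ∧ HasCompactSupport (jac Φ) ∧ 0 < ∫ x, jac Φ x := by
  set b := stdOrthonormalBasis ℝ E
  set d := Module.finrank ℝ E with hd
  have hd1 : (1 : ℝ) ≤ d := by exact_mod_cast Module.finrank_pos (R := ℝ) (M := E)
  set η := δ / d with hη
  have hη0 : 0 < η := by positivity
  set g : ℝ → ℝ := fun t ↦ Real.smoothTransition (t / η) with hgdef
  have hg : ContDiff ℝ 1 g := Real.smoothTransition.contDiff.comp (contDiff_id.div_const η)
  have hmono : Monotone g := fun s t hst ↦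
    Real.smoothTransition.monotone (div_le_div_of_nonneg_right hst hη0.le)
  have hnn : ∀ t, 0 ≤ deriv g t := fun t ↦ hmono.deriv_nonneg
  have hzero : ∀ t, t ∉ Ico 0 η → deriv g t = 0 := by
    intro t ht
    rcases lt_or_ge t 0 with h | h
    · refine IsLocalMin.deriv_eq_zero (Eventually.of_forall fun s ↦ ?_)
      simp only [hgdef]
      rw [Real.smoothTransition.zero_of_nonpos (div_nonpos_of_nonpos_of_nonneg h.le hη0.le)]
      exact Real.smoothTransition.nonneg _
    · refine IsLocalMax.deriv_eq_zero (Eventually.of_forall fun s ↦ ?_)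
      have h' : η ≤ t := not_lt.1 fun h' ↦ ht ⟨h, h'⟩
      simp only [hgdef]
      rw [Real.smoothTransition.one_of_one_le ((one_le_div hη0).2 h')]
      exact Real.smoothTransition.le_one _
  set Φ : E → E := fun x ↦ ∑ i, g (inner ℝ (b i) x) • b i with hΦdef
  have hΦ : ContDiff ℝ 1 Φ := by
    refine ContDiff.sum fun i _ ↦ ?_
    exact (hg.comp (innerSL ℝ (b i)).contDiff).smul contDiff_const
  have hj : ∀ x, jac Φ x = ∏ i, deriv g (inner ℝ (b i) x) := jac_sum_smul_basis b hg
  have h0 : ∀ x, 0 ≤ jac Φ x := fun x ↦ by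
    rw [hj]
    exact Finset.prod_nonneg fun i _ ↦ hnn _
  have hsup : ∀ x, δ ≤ ‖x‖ → jac Φ x = 0 := by
    intro x hx
    by_contra hne
    rw [hj, ← ne_eq, Finset.prod_ne_zero_iff] at hne
    have hx2 : ‖x‖ < δ := by
      have h1 : ∀ i, |inner ℝ (b i) x| < η := fun i ↦ by
        have h := not_imp_comm.1 (hzero (inner ℝ (b i) x)) (hne i (Finset.mem_univ i))
        rw [abs_of_nonneg h.1]
        exact h.2
      calc ‖x‖ = ‖∑ i, inner ℝ (b i) x • b i‖ := by rw [b.sum_repr' x]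
        _ ≤ ∑ i, ‖inner ℝ (b i) x • b i‖ := norm_sum_le _ _
        _ < ∑ i : Fin d, η := by
          refine Finset.sum_lt_sum_of_nonempty ?_ fun i _ ↦ ?_
          · have : NeZero d := ⟨Module.finrank_pos.ne'⟩
            exact Finset.univ_nonempty
          · rw [norm_smul, b.norm_eq_one, mul_one]
            exact h1 i
        _ = δ := by
          simp [hη]
          field_simp
    exact hx2.not_ge hx
  have hcs : HasCompactSupport (jac Φ) :=
    HasCompactSupport.intro (isCompact_closedBall (0 : E) δ) fun x hx ↦ hsup x (by
      simpa using (le_of_lt (by simpa using hx : δ < ‖x‖)))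
  refine ⟨Φ, hΦ, h0, hsup, hcs, ?_⟩
  obtain ⟨t, ht⟩ : ∃ t, deriv g t ≠ 0 := by
    by_contra! h
    have := is_const_of_deriv_eq_zero (hg.differentiable one_ne_zero) h 0 η
    simp [hgdef, hη0.ne'] at this
  refine (continuous_jac hΦ).integral_pos_of_hasCompactSupport_nonneg_nonzero hcs h0
    (x := ∑ i, t • b i) ?_
  rw [hj, Finset.prod_ne_zero_iff]
  intro i _
  rwa [show inner ℝ (b i) (∑ j, t • b j) = t by
    simp [inner_sum, inner_smul_right, OrthonormalBasis.inner_eq_ite]]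

end Bump

section DegreeFormula

variable {E : Type*} [NormedAddCommGroup E] [InnerProductSpace ℝ E] [FiniteDimensional ℝ E]
  [Nontrivial E] [MeasurableSpace E] [BorelSpace E]

omit [FiniteDimensional ℝ E] [Nontrivial E] [MeasurableSpace E] [BorelSpace E] in
lemma jac_comp_sub_const {Φ u : E → E} (hΦ : ContDiff ℝ 1 Φ) (hu : ContDiff ℝ 1 u) (y x : E) :
    jac (fun x ↦ Φ (u x - y)) x = jac Φ (u x - y) * jac u x := by
  have h := jac_comp hΦ (hu.sub contDiff_const : ContDiff ℝ 1 fun x ↦ u x - y) x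
  have h2 : jac (fun x ↦ u x - y) x = jac u x := by simp [jac, fderiv_sub_const]
  rw [h2] at h
  exact h

/-- The localized degree integral is locally constant in the target point. -/
lemma setIntegral_bump_comp_eq {A : Set E} (hA : IsOpen A) (hb : Bornology.IsBounded A)
    {u Φ : E → E} (hu : ContDiff ℝ 1 u) (hΦ : ContDiff ℝ 1 Φ) {δ : ℝ}
    (hδ : ∀ x, δ ≤ ‖x‖ → jac Φ x = 0) {y₀ y₁ : E}
    (hfr : ∀ x ∈ frontier A, δ + dist y₁ y₀ < dist (u x) y₀) :
    ∫ x in A, jac Φ (u x - y₁) * jac u x = ∫ x in A, jac Φ (u x - y₀) * jac u x := by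
  set K := closure A ∩ {x | dist (u x) y₀ ≤ δ + dist y₁ y₀} with hK
  have hKc : IsClosed K :=
    isClosed_closure.inter (isClosed_le (hu.continuous.dist continuous_const) continuous_const)
  have hKA : K ⊆ A := fun x hx ↦ by
    by_contra hxA
    exact (hfr x ⟨hx.1, fun h ↦ hxA (interior_subset h)⟩).not_ge hx.2
  obtain ⟨κ, hκ, hκ01, h1, h0⟩ := exists_smooth_cutoff hKc hA hKA
  have hv : ContDiff ℝ 1 fun x ↦ u x - κ x • (y₁ - y₀) := hu.sub (hκ.smul contDiff_const)
  have hα : ContDiff ℝ 1 fun x ↦ Φ ((u x - κ x • (y₁ - y₀)) - y₀) :=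
    hΦ.comp (hv.sub contDiff_const)
  have hβ : ContDiff ℝ 1 fun x ↦ Φ (u x - y₀) := hΦ.comp (hu.sub contDiff_const)
  have key := setIntegral_jac_congr_frontier hA hb hα hβ fun x hx ↦ by
      filter_upwards [h0 x fun hxA ↦ hx.2 (hA.interior_eq.symm ▸ hxA)] with y hy
      rw [hy, zero_smul, sub_zero]
  simp_rw [jac_comp_sub_const hΦ hu] at key
  rw [← key]
  refine setIntegral_congr_fun hA.measurableSet fun x hx ↦ ?_
  by_cases hxK : x ∈ K
  · have : (fun x ↦ Φ ((u x - κ x • (y₁ - y₀)) - y₀)) =ᶠ[𝓝 x] fun x ↦ Φ (u x - y₁) := by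
      filter_upwards [h1 x hxK] with z hz
      rw [hz, one_smul]
      congr 1
      abel
    rw [jac_congr this, jac_comp_sub_const hΦ hu]
  · have hlt : δ + dist y₁ y₀ < dist (u x) y₀ := not_le.1 fun h ↦ hxK ⟨subset_closure hx, h⟩
    rw [jac_comp_sub_const hΦ hv, hδ (u x - y₁), hδ, zero_mul, zero_mul]
    · have h1 : ‖κ x • (y₁ - y₀)‖ ≤ dist y₁ y₀ := by
        rw [norm_smul, dist_eq_norm, Real.norm_of_nonneg (hκ01 x).1]
        exact mul_le_of_le_one_left (norm_nonneg _) (hκ01 x).2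
      have h2 := norm_sub_norm_le (u x - y₀) (κ x • (y₁ - y₀))
      rw [dist_eq_norm (u x)] at hlt
      rw [show u x - κ x • (y₁ - y₀) - y₀ = u x - y₀ - κ x • (y₁ - y₀) by abel]
      linarith
    · rw [← dist_eq_norm]
      linarith [dist_triangle (u x) y₁ y₀]

lemma setIntegral_bump_comp_eq_of_isPreconnected {A : Set E} (hA : IsOpen A)
    (hb : Bornology.IsBounded A) {u Φ : E → E} (hu : ContDiff ℝ 1 u) (hΦ : ContDiff ℝ 1 Φ) {δ δ₀ : ℝ}
    (hδ : ∀ x, δ ≤ ‖x‖ → jac Φ x = 0) (hδδ₀ : δ < δ₀) {V : Set E} (hV : IsPreconnected V)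
    (hfr : ∀ y ∈ V, ∀ x ∈ frontier A, δ₀ ≤ dist (u x) y) {y₀ y₁ : E} (hy₀ : y₀ ∈ V)
    (hy₁ : y₁ ∈ V) :
    ∫ x in A, jac Φ (u x - y₀) * jac u x = ∫ x in A, jac Φ (u x - y₁) * jac u x := by
  refine hV.induction₂ (fun y₀ y₁ ↦ ∫ x in A, jac Φ (u x - y₀) * jac u x =
    ∫ x in A, jac Φ (u x - y₁) * jac u x) (fun y hy ↦ ?_) (fun _ _ _ _ _ _ h h' ↦ h.trans h')
    (fun _ _ _ _ h ↦ h.symm) hy₀ hy₁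
  filter_upwards [nhdsWithin_le_nhds (ball_mem_nhds y (sub_pos.2 hδδ₀))] with z hz
  refine (setIntegral_bump_comp_eq hA hb hu hΦ hδ fun x hx ↦ ?_).symm
  have := hfr y hy x hx
  rw [mem_ball] at hz
  linarith

/-- The degree formula: if `J` has total integral zero and is supported in a connected set that
stays away from the image of the frontier of `A`, its pullback has integral zero over `A`. -/
lemma setIntegral_comp_mul_jac_eq_zero {A : Set E} (hA : IsOpen A) (hb : Bornology.IsBounded A)
    {u : E → E} (hu : ContDiff ℝ 1 u) {J : E → ℝ} (hJ : Continuous J) (hJs : HasCompactSupport J)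
    (hJ0 : ∫ y, J y = 0) {V : Set E} (hV : IsPreconnected V) (hJV : tsupport J ⊆ V) {δ₀ : ℝ}
    (hδ₀ : 0 < δ₀) (hfr : ∀ y ∈ V, ∀ x ∈ frontier A, δ₀ ≤ dist (u x) y) :
    ∫ x in A, J (u x) * jac u x = 0 := by
  set I := ∫ x in A, |jac u x| with hI
  have hjint := integrableOn_jac hu hb
  have hJT : ∫ y in tsupport J, J y = 0 := by
    rw [setIntegral_eq_integral_of_forall_compl_eq_zero fun x hx ↦
      image_eq_zero_of_notMem_tsupport hx, hJ0]
  suffices h : ∀ ε > 0, |∫ x in A, J (u x) * jac u x| ≤ ε * I by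
    by_contra hne
    have hpos := abs_pos.2 hne
    have hI0 : 0 ≤ I := integral_nonneg fun _ ↦ abs_nonneg _
    have := h (|∫ x in A, J (u x) * jac u x| / (2 * (I + 1))) (by positivity)
    rw [div_mul_eq_mul_div, le_div_iff₀ (by positivity)] at this
    nlinarith
  intro ε hε
  obtain ⟨η, hη, hηJ⟩ := Metric.uniformContinuous_iff.1
    (hJs.uniformContinuous_of_continuous hJ) ε hε
  obtain ⟨Φ, hΦ, hΦ0, hΦs, hΦc, hΦI⟩ := exists_jac_bump (E := E) (δ := min η (δ₀ / 2))
    (by positivity)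
  set m := ∫ x, jac Φ x with hm
  set T := tsupport J with hT
  have hTc : IsCompact T := hJs
  have hΦcont := continuous_jac hΦ
  have hshift : ∀ z : E, Integrable fun y ↦ jac Φ (z - y) := fun z ↦
    (hΦcont.integrable_of_hasCompactSupport hΦc).comp_sub_left z
  have hconv : ∀ z, |m * J z - ∫ y in T, J y * jac Φ (z - y)| ≤ ε * m := by
    intro z
    have e1 : ∫ y in T, J y * jac Φ (z - y) = ∫ y, J y * jac Φ (z - y) :=
      setIntegral_eq_integral_of_forall_compl_eq_zero fun x hx ↦ by
        rw [image_eq_zero_of_notMem_tsupport hx, zero_mul]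
    have e2 : m = ∫ y, jac Φ (z - y) := (integral_sub_left_eq_self _ _ z).symm
    have hintgr : Integrable fun y ↦ J y * jac Φ (z - y) :=
      (hJ.mul (hΦcont.comp (continuous_const.sub continuous_id))).integrable_of_hasCompactSupport
        hJs.mul_right
    rw [← Real.norm_eq_abs, e1, e2, ← integral_mul_const, ← integral_sub ((hshift z).mul_const _) hintgr,
      ← integral_const_mul]
    refine norm_integral_le_of_norm_le ((hshift z).const_mul ε) (Eventually.of_forall fun y ↦ ?_)
    rw [show jac Φ (z - y) * J z - J y * jac Φ (z - y) = (J z - J y) * jac Φ (z - y) by ring,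
      norm_mul, Real.norm_of_nonneg (hΦ0 _)]
    by_cases hy : min η (δ₀ / 2) ≤ ‖z - y‖
    · rw [hΦs _ hy, mul_zero, mul_zero]
    · refine mul_le_mul_of_nonneg_right ?_ (hΦ0 _)
      rw [← dist_eq_norm]
      refine (hηJ ?_).le
      rw [dist_eq_norm]
      exact (not_le.1 hy).trans_le (min_le_left _ _)
  have hF : Continuous fun p : E × E ↦ J p.2 * (jac Φ (u p.1 - p.2) * jac u p.1) := by
    have := continuous_jac hu
    have := hu.continuous
    fun_prop
  have hswap : ∫ x in A, ∫ y in T, J y * (jac Φ (u x - y) * jac u x) = 0 := by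
    rw [integral_integral_swap]
    · rcases T.eq_empty_or_nonempty with hTe | ⟨y₀, hy₀⟩
      · simp [hTe]
      · have : ∀ y ∈ T, ∫ x in A, J y * (jac Φ (u x - y) * jac u x) =
            J y * ∫ x in A, jac Φ (u x - y₀) * jac u x := fun y hy ↦ by
          rw [integral_const_mul]
          congr 1
          exact setIntegral_bump_comp_eq_of_isPreconnected hA hb hu hΦ hΦs
            ((min_le_right _ _).trans_lt (half_lt_self hδ₀)) hV hfr (hJV hy) (hJV hy₀)
        rw [setIntegral_congr_fun hTc.measurableSet this, integral_mul_const, hJT, zero_mul]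
    · rw [Measure.prod_restrict]
      exact (hF.continuousOn.integrableOn_compact
        (hb.isCompact_closure.prod hTc)).mono_set (prod_mono subset_closure Subset.rfl)
  have hinner : Continuous fun x ↦ ∫ y in T, J y * jac Φ (u x - y) := by
    refine continuous_parametric_integral_of_continuous ?_ hTc
    have := hu.continuous
    fun_prop
  have hcomp : Continuous fun x ↦ J (u x) := hJ.comp hu.continuous
  have hbd : ∀ g : E → ℝ, Continuous g → IntegrableOn g A := fun g hg ↦
    (hg.continuousOn.integrableOn_compact hb.isCompact_closure).mono_set subset_closure
  have hmain : m * ∫ x in A, J (u x) * jac u x =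
      ∫ x in A, (m * J (u x) - ∫ y in T, J y * jac Φ (u x - y)) * jac u x := by
    have i1 : IntegrableOn (fun x ↦ m * J (u x) * jac u x) A :=
      hbd _ ((continuous_const.mul hcomp).mul (continuous_jac hu))
    have i2 : IntegrableOn (fun x ↦ (∫ y in T, J y * jac Φ (u x - y)) * jac u x) A :=
      hbd _ (hinner.mul (continuous_jac hu))
    simp_rw [sub_mul]
    rw [integral_sub i1 i2]
    simp_rw [← integral_mul_const, mul_assoc]
    rw [hswap, sub_zero, integral_const_mul]
  have hle : |m * ∫ x in A, J (u x) * jac u x| ≤ ε * m * I := by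
    rw [hmain, hI, ← integral_const_mul, ← Real.norm_eq_abs]
    refine norm_integral_le_of_norm_le (hjint.abs.const_mul _) (Eventually.of_forall fun x ↦ ?_)
    rw [norm_mul]
    exact mul_le_mul_of_nonneg_right (hconv _) (norm_nonneg _)
  rw [abs_mul, abs_of_pos hΦI] at hle
  refine le_of_mul_le_mul_left ?_ hΦI
  linarith

end DegreeFormula

section Transfer

variable {E : Type*} [NormedAddCommGroup E] [InnerProductSpace ℝ E] [FiniteDimensional ℝ E]

lemma exists_contDiff_dist_lt_of_isCompact {φ : E → E} (hφ : Continuous φ) {C : Set E}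
    (hC : IsCompact C) {ε : ℝ} (hε : 0 < ε) :
    ∃ ψ : E → E, ContDiff ℝ 1 ψ ∧ ∀ x ∈ C, dist (ψ x) (φ x) < ε := by
  obtain ⟨R, hR⟩ := hC.isBounded.subset_ball (0 : E)
  obtain ⟨κ, hκ, -, h1, h0⟩ := exists_smooth_cutoff hC.isClosed isOpen_ball hR
  have hcs : HasCompactSupport fun x ↦ κ x • φ x :=
    HasCompactSupport.intro (isCompact_closedBall (0 : E) R) fun x hx ↦ by
      rw [(h0 x fun h ↦ hx (ball_subset_closedBall h)).eq_of_nhds, zero_smul]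
  obtain ⟨ψ, hψ, hd⟩ := (hcs.uniformContinuous_of_continuous
    (hκ.continuous.smul hφ)).exists_contDiff_dist_le hε
  refine ⟨ψ, hψ.of_le (by exact_mod_cast le_top), fun x hx ↦ ?_⟩
  have := hd x
  rwa [(h1 x hx).eq_of_nhds, one_smul] at this

omit [FiniteDimensional ℝ E] in
lemma jac_comp_sub (Φ : E → E) (hΦ : ContDiff ℝ 1 Φ) (y x : E) :
    jac (fun x ↦ Φ (x - y)) x = jac Φ (x - y) := by
  refine (jac_comp_sub_const hΦ contDiff_id y x).trans ?_
  simp [jac, ContinuousLinearMap.det]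

/-- Moving the bump `jac Φ (· - y)` to `jac Φ (· - z)` inside a ball, without changing the map
outside the ball. -/
lemma exists_jac_bump_shift {q : E} {R : ℝ} (hR : 0 < R) {y z : E} (hy : dist y q < R / 8)
    (hz : dist z q < R / 8) {Φ : E → E} (hΦ : ContDiff ℝ 1 Φ)
    (hΦs : ∀ x, R / 8 ≤ ‖x‖ → jac Φ x = 0) :
    ∃ α : E → E, ContDiff ℝ 1 α ∧ (∀ x, jac α x = jac Φ (x - z)) ∧
      ∀ x ∉ closedBall q R, α x = Φ (x - y) := by
  obtain ⟨κ, hκ, hκ01, h1, h0⟩ := exists_smooth_cutoff (isClosed_closedBall (x := q) (ε := R / 2))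
    (isOpen_ball (x := q) (ε := R)) (closedBall_subset_ball (by linarith))
  have hT : ContDiff ℝ 1 fun x ↦ x + κ x • (y - z) := contDiff_id.add (hκ.smul contDiff_const)
  refine ⟨fun x ↦ Φ ((x + κ x • (y - z)) - y), hΦ.comp (hT.sub contDiff_const), fun x ↦ ?_,
    fun x hx ↦ ?_⟩
  · by_cases hx : x ∈ closedBall q (R / 2)
    · have : (fun x ↦ Φ ((x + κ x • (y - z)) - y)) =ᶠ[𝓝 x] fun x ↦ Φ (x - z) := by
        filter_upwards [h1 x hx] with w hw
        rw [hw, one_smul]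
        congr 1
        abel
      rw [jac_congr this, jac_comp_sub _ hΦ]
    · rw [mem_closedBall, not_le] at hx
      rw [jac_comp_sub_const hΦ hT, hΦs, hΦs (x - z), zero_mul]
      · rw [← dist_eq_norm]
        linarith [dist_triangle x z q]
      · have e1 : ‖κ x • (y - z)‖ ≤ dist y z := by
          rw [norm_smul, dist_eq_norm, Real.norm_of_nonneg (hκ01 x).1]
          exact mul_le_of_le_one_left (norm_nonneg _) (hκ01 x).2
        have e2 := norm_sub_le_norm_add (x - y) (κ x • (y - z))
        rw [show x + κ x • (y - z) - y = x - y + κ x • (y - z) by abel]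
        rw [← dist_eq_norm] at e2
        linarith [dist_triangle x y q, dist_triangle_right y z q]
  · simp only
    rw [(h0 x fun h ↦ hx (ball_subset_closedBall h)).eq_of_nhds, zero_smul, add_zero]

variable [Nontrivial E] [MeasurableSpace E] [BorelSpace E]

/-- Precomposing with a map close to the identity on one part of the frontier, and avoiding the
set where `α` and `β` differ on the other part, does not change the integral of
`jac α - jac β`. -/
lemma setIntegral_jac_sub_jac_comp {A M K N : Set E} (hA : IsOpen A) (hb : Bornology.IsBounded A)
    (hM : IsClosed M) (hN : IsClosed N) (hfr : frontier A ⊆ M ∪ K) {α β w : E → E}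
    (hα : ContDiff ℝ 1 α) (hβ : ContDiff ℝ 1 β) (hw : ContDiff ℝ 1 w) {η : ℝ} (hη : 0 < η)
    (hαβ : ∀ x ∉ N, α x = β x) (hαM : ∀ x ∈ thickening η M, jac α x = 0)
    (hβM : ∀ x ∈ thickening η M, jac β x = 0) (hKN : ∀ x ∈ thickening η K, x ∉ N)
    (hwM : ∀ x ∈ M, dist (w x) x < η / 2) (hwK : ∀ x ∈ K, w x ∉ N) :
    ∫ x in A, (jac α x - jac β x) = ∫ x in A, (jac (α ∘ w) x - jac (β ∘ w) x) := by
  set Y := thickening (η / 2) M ∩ {x | dist (w x) x < η / 2} with hY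
  have hYo : IsOpen Y :=
    isOpen_thickening.inter (isOpen_lt (hw.continuous.dist continuous_id) continuous_const)
  obtain ⟨κ, hκ, hκ01, h1, h0⟩ := exists_smooth_cutoff hM hYo fun x hx ↦
    ⟨self_subset_thickening (half_pos hη) _ hx, hwM x hx⟩
  set v : E → E := fun x ↦ w x + κ x • (x - w x) with hvdef
  have hv : ContDiff ℝ 1 v := hw.add (hκ.smul (contDiff_id.sub hw))
  have hvY : ∀ x ∈ Y, dist (v x) x < η / 2 := fun x hx ↦ by
    have e : v x - x = (1 - κ x) • (w x - x) := by
      simp only [hvdef, sub_smul, one_smul, smul_sub]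
      abel
    rw [dist_eq_norm, e, norm_smul, Real.norm_of_nonneg (sub_nonneg.2 (hκ01 x).2), ← dist_eq_norm]
    exact (mul_le_of_le_one_left dist_nonneg (by linarith [(hκ01 x).1])).trans_lt hx.2
  have hvoff : ∀ x ∉ Y, v =ᶠ[𝓝 x] w := fun x hx ↦ by
    filter_upwards [h0 x hx] with y hy
    simp [hvdef, hy]
  have hYth : ∀ x ∈ Y, ∀ y, dist y x < η / 2 → y ∈ thickening η M := fun x hx y hy ↦ by
    obtain ⟨z, hz, hxz⟩ := mem_thickening_iff.1 hx.1
    exact mem_thickening_iff.2 ⟨z, hz, by linarith [dist_triangle y x z]⟩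
  have hnear : ∀ x ∉ N, α =ᶠ[𝓝 x] β := fun x hx ↦ by
    filter_upwards [hN.isOpen_compl.mem_nhds hx] with y hy using hαβ y hy
  have hkey := setIntegral_jac_sub_jac_congr_frontier hA hb hβ hα (hβ.comp hv) (hα.comp hv)
    fun x hx ↦ by
      by_cases hxM : x ∈ M
      · right
        have : v =ᶠ[𝓝 x] id := by
          filter_upwards [h1 x hxM] with y hy
          simp [hvdef, hy]
        exact ⟨(this.fun_comp α).symm, (this.fun_comp β).symm⟩
      · left
        have hxK := (hfr hx).resolve_left hxM
        refine ⟨hnear x (hKN x (self_subset_thickening hη _ hxK)), ?_⟩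
        have hvN : v x ∉ N := by
          by_cases hxY : x ∈ Y
          · exact hKN _ (mem_thickening_iff.2 ⟨x, hxK, (hvY x hxY).trans (half_lt_self hη)⟩)
          · rw [(hvoff x hxY).eq_of_nhds]
            exact hwK x hxK
        exact (hnear _ hvN).comp_tendsto hv.continuous.continuousAt
  rw [hkey]
  congr 1
  ext x
  by_cases hx : x ∈ Y
  · have e1 := hYth x hx _ (hvY x hx)
    have e2 := hYth x hx _ hx.2
    simp only [jac_comp hα hv, jac_comp hβ hv, jac_comp hα hw, jac_comp hβ hw, hαM _ e1, hαM _ e2,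
      hβM _ e1, hβM _ e2, zero_mul]
  · have := hvoff x hx
    rw [jac_congr (this.fun_comp α), jac_congr (this.fun_comp β)]

end Transfer

section Extension

variable {E : Type*} [NormedAddCommGroup E] [InnerProductSpace ℝ E] [FiniteDimensional ℝ E]

lemma exists_continuous_eqOn {α : Type*} [TopologicalSpace α] [NormalSpace α] {s : Set α}
    (hs : IsClosed s) {g : α → E} (hg : ContinuousOn g s) :
    ∃ g' : α → E, Continuous g' ∧ EqOn g' g s := by
  have : TietzeExtension.{_} E := TietzeExtension.of_tvs ℝ
  obtain ⟨h, hh⟩ := ContinuousMap.exists_restrict_eq hs ⟨s.domRestrict g, hg.domRestrict⟩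
  refine ⟨h, h.continuous, fun x hx ↦ ?_⟩
  exact congrArg (fun k : C(s, E) ↦ k ⟨x, hx⟩) hh

/-- A continuous map onto the complement of an open spherical cap, fixing its boundary circle. -/
lemma exists_continuous_to_cap_compl {p : E} (hp : ‖p‖ = 1) {c : ℝ} (hc₁ : -1 < c) (hc₂ : c < 1) :
    ∃ H : E → E, Continuous H ∧ (∀ x, ‖H x‖ = 1 ∧ inner ℝ (H x) p ≤ c) ∧
      ∀ x, ‖x‖ = 1 → inner ℝ x p = c → H x = x := by
  set s := √(1 - c ^ 2) with hs
  have hs2 : s ^ 2 = 1 - c ^ 2 := Real.sq_sqrt (by nlinarith)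
  have hs0 : 0 < s := Real.sqrt_pos.2 (by nlinarith)
  have hpp : inner ℝ p p = (1 : ℝ) := by rw [real_inner_self_eq_norm_sq, hp, one_pow]
  set π : E → E := fun x ↦ x - (inner ℝ x p : ℝ) • p with hπ
  have hπp : ∀ x, inner ℝ (π x) p = 0 := fun x ↦ by
    simp [hπ, inner_sub_left, inner_smul_left, hp]
  set W : E → E := fun x ↦ ((s / max s ‖π x‖) / (1 - c)) • π x with hW
  have hmax : ∀ x, 0 < max s ‖π x‖ := fun x ↦ lt_max_of_lt_left hs0
  have hWp : ∀ x, inner ℝ (W x) p = 0 := fun x ↦ by simp [hW, inner_smul_left, hπp]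
  have hπc : Continuous π := by fun_prop
  have hWc : Continuous W := by
    have : Continuous fun x ↦ s / max s ‖π x‖ :=
      continuous_const.div (by fun_prop) fun x ↦ (hmax x).ne'
    fun_prop
  have hWn : ∀ x, ‖W x‖ ^ 2 * (1 - c) ≤ 1 + c := fun x ↦ by
    have h1 : ‖W x‖ ≤ s / (1 - c) := by
      rw [hW, norm_smul, Real.norm_of_nonneg
        (div_nonneg (div_nonneg hs0.le (hmax x).le) (by linarith))]
      rw [div_mul_eq_mul_div, div_le_div_iff_of_pos_right (by linarith), div_mul_eq_mul_div,
        div_le_iff₀ (hmax x)]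
      exact mul_le_mul_of_nonneg_left (le_max_right _ _) hs0.le
    have h2 : ‖W x‖ ^ 2 ≤ (s / (1 - c)) ^ 2 := pow_le_pow_left₀ (norm_nonneg _) h1 2
    rw [div_pow, hs2, le_div_iff₀ (by nlinarith)] at h2
    have h3 : 0 < 1 - c := by linarith
    nlinarith
  set H : E → E := fun x ↦ (‖W x‖ ^ 2 + 1)⁻¹ • ((2 : ℝ) • W x + (‖W x‖ ^ 2 - 1) • p) with hH
  have hpos : ∀ x, 0 < ‖W x‖ ^ 2 + 1 := fun x ↦ by positivity
  refine ⟨H, ?_, fun x ↦ ⟨?_, ?_⟩, fun x hx hxc ↦ ?_⟩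
  · have : Continuous fun x ↦ (‖W x‖ ^ 2 + 1)⁻¹ :=
      Continuous.inv₀ (by fun_prop) fun x ↦ (hpos x).ne'
    fun_prop
  · have h1 : ‖(2 : ℝ) • W x + (‖W x‖ ^ 2 - 1) • p‖ ^ 2 = (‖W x‖ ^ 2 + 1) ^ 2 := by
      rw [norm_add_sq_real, norm_smul (2 : ℝ), norm_smul (‖W x‖ ^ 2 - 1), hp, inner_smul_left,
        inner_smul_right, hWp, mul_pow, mul_pow, Real.norm_eq_abs, Real.norm_eq_abs, sq_abs, sq_abs]
      simp only [mul_zero, one_pow]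
      ring
    have h2 : ‖(2 : ℝ) • W x + (‖W x‖ ^ 2 - 1) • p‖ = ‖W x‖ ^ 2 + 1 :=
      (pow_left_inj₀ (norm_nonneg _) (hpos x).le two_ne_zero).1 h1
    simp only [hH]
    rw [norm_smul, h2, norm_inv, Real.norm_of_nonneg (hpos x).le, inv_mul_cancel₀ (hpos x).ne']
  · have : inner ℝ (H x) p = (‖W x‖ ^ 2 + 1)⁻¹ * (‖W x‖ ^ 2 - 1) := by
      simp [hH, inner_smul_left, inner_add_left, hWp, hp]
    rw [this, inv_mul_le_iff₀ (hpos x)]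
    linarith [hWn x]
  · have h1 : ‖π x‖ ^ 2 = s ^ 2 := by
      rw [hπ, norm_sub_sq_real, inner_smul_right, norm_smul, hx, hxc, hp, hs2]
      simp
      ring
    have h2 : ‖π x‖ = s := (pow_left_inj₀ (norm_nonneg _) hs0.le two_ne_zero).1 h1
    have h3 : 1 - c ≠ 0 := by linarith
    have h4 : W x = (1 - c)⁻¹ • π x := by
      simp only [hW, h2, max_self, div_self hs0.ne', one_div]
    have h5 : ‖W x‖ ^ 2 = (1 + c) / (1 - c) := by
      rw [h4, norm_smul, mul_pow, h1, hs2, Real.norm_eq_abs, sq_abs]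
      field_simp
      ring
    have h6 : x = π x + c • p := by simp [hπ, hxc]
    have h7 : ((1 + c) / (1 - c) + 1)⁻¹ = (1 - c) / 2 := by
      field_simp
      ring
    have h8 : (1 + c) / (1 - c) - 1 = 2 * c / (1 - c) := by
      field_simp
      ring
    simp only [hH]
    rw [h5, h7, h8, h4, smul_add, smul_smul, smul_smul, smul_smul]
    rw [show (1 - c) / 2 * 2 * (1 - c)⁻¹ = 1 by field_simp,
      show (1 - c) / 2 * (2 * c / (1 - c)) = c by field_simp, one_smul, ← h6]

/-- The inverse of an injective piece of a sphere extends to a map of the ambient space into the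
unit ball that keeps the rest of the image of the sphere away from that piece. -/
lemma exists_continuous_leftInverse_on_cap {p : E} (hp : ‖p‖ = 1) {c : ℝ} (hc₁ : -1 < c)
    (hc₂ : c < 1) {f : E → E} (hf : Continuous f)
    (hinj : ∀ x, ‖x‖ = 1 → c ≤ inner ℝ x p → ∀ y, ‖y‖ = 1 → f y = f x → y = x) :
    ∃ G : E → E, Continuous G ∧ (∀ x, ‖G x‖ ≤ 1) ∧ (∀ x, ‖x‖ = 1 → ‖G (f x)‖ = 1) ∧
      (∀ x, ‖x‖ = 1 → c ≤ inner ℝ x p → G (f x) = x) ∧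
      ∀ x, ‖x‖ = 1 → inner ℝ x p ≤ c → inner ℝ (G (f x)) p ≤ c := by
  classical
  set D := sphere (0 : E) 1 ∩ {x | c ≤ inner ℝ x p} with hD
  set S := sphere (0 : E) 1 ∩ {x | inner ℝ x p ≤ c} with hS
  have hDc : IsCompact D := (isCompact_sphere _ _).inter_right
    (isClosed_le continuous_const (by fun_prop))
  have hSc : IsCompact S := (isCompact_sphere _ _).inter_right
    (isClosed_le (by fun_prop) continuous_const)
  have hinjD : InjOn f D := fun x hx y hy h ↦
    hinj y (by simpa using hy.1) hy.2 x (by simpa using hx.1) h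
  have hemb : IsClosedEmbedding fun x : D ↦ f x := by
    have : CompactSpace D := isCompact_iff_compactSpace.1 hDc
    exact (hf.comp continuous_subtype_val).isClosedEmbedding
      fun x y h ↦ Subtype.ext (hinjD x.2 y.2 h)
  have : TietzeExtension.{_} E := TietzeExtension.of_tvs ℝ
  obtain ⟨h, hh⟩ := ContinuousMap.exists_extension hemb ⟨fun x : D ↦ (x : E), continuous_subtype_val⟩
  have hhD : ∀ x ∈ D, h (f x) = x := fun x hx ↦ congrArg (fun k : C(D, E) ↦ k ⟨x, hx⟩) hh
  obtain ⟨H, hHc, hH1, hH2⟩ := exists_continuous_to_cap_compl hp hc₁ hc₂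
  set g : E → E := fun y ↦ if y ∈ f '' D then h y else H (h y) with hg
  have hgD : ∀ x ∈ D, g (f x) = x := fun x hx ↦ by
    rw [hg]
    simp only [mem_image_of_mem f hx, if_true, hhD x hx]
  have hgS : EqOn g (H ∘ h) (f '' S) := by
    rintro _ ⟨x, hx, rfl⟩
    by_cases hxD : f x ∈ f '' D
    · obtain ⟨y, hy, hxy⟩ := hxD
      have : x = y := hinj y (by simpa using hy.1) hy.2 x (by simpa using hx.1) hxy.symm
      subst this
      rw [hgD x hy, Function.comp_apply, hhD x hy,
        hH2 x (by simpa using hx.1) (le_antisymm hx.2 hy.2)]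
    · simp only [hg, hxD, if_false, Function.comp_apply]
  have hgDe : EqOn g h (f '' D) := by
    rintro _ ⟨x, hx, rfl⟩
    rw [hgD x hx, hhD x hx]
  have hDcl := (hDc.image hf).isClosed
  have hScl := (hSc.image hf).isClosed
  have hgc : ContinuousOn g (f '' D ∪ f '' S) :=
    (h.continuous.continuousOn.congr hgDe).union_of_isClosed
      ((hHc.comp h.continuous).continuousOn.congr hgS) hDcl hScl
  obtain ⟨G, hG, hGg⟩ := exists_continuous_eqOn (hDcl.union hScl) hgc
  have hm : ∀ x, 0 < max 1 ‖G x‖ := fun x ↦ lt_max_of_lt_left one_pos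
  have hGD : ∀ x ∈ D, G (f x) = x := fun x hx ↦ by
    rw [hGg (Or.inl (mem_image_of_mem f hx)), hgD x hx]
  have hGS : ∀ x ∈ S, G (f x) = H (h (f x)) := fun x hx ↦ by
    rw [hGg (Or.inr (mem_image_of_mem f hx)), hgS (mem_image_of_mem f hx)]
    rfl
  have hG1 : ∀ x, ‖x‖ = 1 → ‖G (f x)‖ = 1 := fun x hx ↦ by
    rcases le_total c (inner ℝ x p) with hxc | hxc
    · rw [hGD x ⟨by simpa using hx, hxc⟩, hx]
    · rw [hGS x ⟨by simpa using hx, hxc⟩]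
      exact (hH1 _).1
  have hcl : ∀ x, ‖x‖ = 1 → (max 1 ‖G (f x)‖)⁻¹ • G (f x) = G (f x) := fun x hx ↦ by
    rw [hG1 x hx, max_self, inv_one, one_smul]
  refine ⟨fun x ↦ (max 1 ‖G x‖)⁻¹ • G x, ?_, fun x ↦ ?_, fun x hx ↦ ?_, fun x hx hxc ↦ ?_,
    fun x hx hxc ↦ ?_⟩
  · have : Continuous fun x ↦ (max 1 ‖G x‖)⁻¹ :=
      Continuous.inv₀ (by fun_prop) fun x ↦ (hm x).ne'
    fun_prop
  · rw [norm_smul, norm_inv, Real.norm_of_nonneg (hm x).le, inv_mul_le_iff₀ (hm x), mul_one]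
    exact le_max_right _ _
  · simp only [hcl x hx]
    exact hG1 x hx
  · simp only [hcl x hx]
    exact hGD x ⟨by simpa using hx, hxc⟩
  · simp only [hcl x hx]
    rw [hGS x ⟨by simpa using hx, hxc⟩]
    exact (hH1 _).2

end Extension

section CompactConnected

variable {E : Type*} [NormedAddCommGroup E] [NormedSpace ℝ E] [FiniteDimensional ℝ E]

lemma IsOpen.exists_isCompact_isPreconnected_superset {V T : Set E} (hV : IsOpen V)
    (hVc : IsPreconnected V) (hT : IsCompact T) (hTV : T ⊆ V) :
    ∃ W, IsCompact W ∧ IsPreconnected W ∧ T ⊆ W ∧ W ⊆ V := by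
  have : ProperSpace E := FiniteDimensional.proper ℝ E
  rcases T.eq_empty_or_nonempty with rfl | ⟨v, hv⟩
  · exact ⟨∅, isCompact_empty, isPreconnected_empty, Subset.rfl, empty_subset _⟩
  have hpath : IsPathConnected V := hV.isConnected_iff_isPathConnected.1 ⟨⟨v, hTV hv⟩, hVc⟩
  have hloc : ∀ x, ∃ W : Set E, x ∈ V → IsCompact W ∧ IsPreconnected W ∧ v ∈ W ∧ W ⊆ V ∧
      W ∈ 𝓝 x := by
    intro x
    by_cases hx : x ∈ V
    swap
    · exact ⟨∅, fun h ↦ (hx h).elim⟩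
    obtain ⟨ε, hε, hεV⟩ := nhds_basis_closedBall.mem_iff.1 (hV.mem_nhds hx)
    obtain ⟨γ, hγ⟩ := hpath.joinedIn v (hTV hv) x hx
    refine ⟨range γ ∪ closedBall x ε, fun _ ↦ ⟨(isCompact_range γ.continuous).union
      (isCompact_closedBall _ _), ?_, Or.inl ⟨0, γ.source⟩,
      union_subset (range_subset_iff.2 hγ) hεV,
      mem_of_superset (closedBall_mem_nhds x hε) subset_union_right⟩⟩
    exact (isPreconnected_range γ.continuous).union x ⟨1, γ.target⟩
      (mem_closedBall_self hε.le) (convex_closedBall x ε).isPreconnected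
  choose W hW using hloc
  obtain ⟨t, ht, htW⟩ := hT.elim_nhds_subcover W fun x hx ↦ (hW x (hTV hx)).2.2.2.2
  refine ⟨⋃ x ∈ t, W x, t.isCompact_biUnion fun x hx ↦ (hW x (hTV (ht x hx))).1, ?_, htW,
    iUnion₂_subset fun x hx ↦ (hW x (hTV (ht x hx))).2.2.2.1⟩
  have e : (⋃ x ∈ t, W x) = ⋃₀ (W '' (t : Set E)) := by
    rw [sUnion_image]
    rfl
  rw [e]
  refine isPreconnected_sUnion v _ ?_ ?_
  · rintro _ ⟨x, hx, rfl⟩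
    exact (hW x (hTV (ht x hx))).2.2.1
  · rintro _ ⟨x, hx, rfl⟩
    exact (hW x (hTV (ht x hx))).2.1

lemma IsCompact.exists_forall_dist_lt {α β : Type*} [PseudoMetricSpace α] [PseudoMetricSpace β]
    {X : Set α} (hX : IsCompact X) {g : α → β} (hg : Continuous g) {ε : ℝ} (hε : 0 < ε) :
    ∃ δ > 0, ∀ a ∈ X, ∀ b, dist b a < δ → dist (g b) (g a) < ε := by
  have h := hX.uniformContinuousAt_of_continuousAt g (fun a _ ↦ hg.continuousAt)
    (dist_mem_uniformity hε)
  obtain ⟨δ, hδ, h⟩ := mem_uniformity_dist.1 h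
  refine ⟨δ, hδ, fun a ha b hab ↦ ?_⟩
  rw [dist_comm] at hab ⊢
  exact h hab ha

end CompactConnected

section Separation

variable {E : Type*} [NormedAddCommGroup E] [InnerProductSpace ℝ E] [FiniteDimensional ℝ E]
  [Nontrivial E] [MeasurableSpace E] [BorelSpace E]

/-- Near an injectively embedded piece of the image of a sphere, the complement of the image is
not contained in one connected open set avoiding the image. -/
lemma not_diff_image_sphere_subset {p : E} (hp : ‖p‖ = 1) {c : ℝ} (hc₁ : -1 < c)
    (hc₂ : c < 1) {f : E → E} (hf : Continuous f)
    (hinj : ∀ x, ‖x‖ = 1 → c ≤ inner ℝ x p → ∀ y, ‖y‖ = 1 → f y = f x → y = x)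
    {O V : Set E} (hO : IsOpen O) (hpO : f p ∈ O) (hV : IsOpen V) (hVc : IsPreconnected V)
    (hVX : Disjoint V (f '' sphere 0 1)) : ¬ O \ f '' sphere 0 1 ⊆ V := by
  intro hOV
  wlog hOb : Bornology.IsBounded O generalizing O
  · exact this (hO.inter isOpen_ball) ⟨hpO, mem_ball_self one_pos⟩
      ((sdiff_subset_sdiff_left inter_subset_left).trans hOV)
      (isBounded_ball.subset inter_subset_right)
  obtain ⟨G₀, hG₀, -, hG₀1, hG₀D, hG₀K⟩ :=
    exists_continuous_leftInverse_on_cap hp hc₁ hc₂ hf hinj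
  set X := f '' sphere (0 : E) 1 with hX
  have hXc : IsCompact X := (isCompact_sphere _ _).image hf
  have hpp : inner ℝ p p = (1 : ℝ) := by rw [real_inner_self_eq_norm_sq, hp, one_pow]
  obtain ⟨ρ, hρ, hρs⟩ := Metric.isOpen_iff.1
    ((hO.preimage hf).inter (isOpen_lt continuous_const (by fun_prop) : IsOpen {x | c < inner ℝ x p}))
    p ⟨hpO, by simpa only [mem_ofPred_eq, hpp] using hc₂⟩
  set R := ρ / 4 with hR
  have hR0 : 0 < R := by positivity
  have hRO : ∀ x, dist x p ≤ 2 * R → f x ∈ O ∧ c < inner ℝ x p := fun x hx ↦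
    hρs (mem_ball.2 (by linarith))
  set t := min (R / 16) (1 / 2) with ht
  have ht0 : 0 < t := by positivity
  have htR : t ≤ R / 16 := min_le_left _ _
  have ht1 : t ≤ 1 / 2 := min_le_right _ _
  set y := (1 - t) • p with hy
  set z := (1 + t) • p with hz
  have hyn : ‖y‖ = 1 - t := by
    rw [hy, norm_smul, hp, mul_one, Real.norm_of_nonneg (by linarith)]
  have hzn : ‖z‖ = 1 + t := by
    rw [hz, norm_smul, hp, mul_one, Real.norm_of_nonneg (by linarith)]
  have hyp : dist y p = t := by
    rw [dist_eq_norm, hy, sub_smul, one_smul, sub_sub_cancel_left, norm_neg, norm_smul, hp, mul_one,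
      Real.norm_of_nonneg ht0.le]
  have hzp : dist z p = t := by
    rw [dist_eq_norm, hz, add_smul, one_smul, add_sub_cancel_left, norm_smul, hp, mul_one,
      Real.norm_of_nonneg ht0.le]
  set η := t / 2 with hη
  have hη0 : 0 < η := by positivity
  obtain ⟨Φ, hΦ, hΦ0, hΦs, hΦc, hΦI⟩ := exists_jac_bump (E := E) hη0
  obtain ⟨α, hα, hαj, hαβ⟩ := exists_jac_bump_shift (q := p) hR0 (y := y) (z := z)
    (by linarith) (by linarith) hΦ fun x hx ↦ hΦs x (by linarith)
  set β : E → E := fun x ↦ Φ (x - y) with hβdef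
  have hβ : ContDiff ℝ 1 β := hΦ.comp (contDiff_id.sub contDiff_const)
  have hβj : ∀ x, jac β x = jac Φ (x - y) := fun x ↦ jac_comp_sub Φ hΦ y x
  have hαz : ∀ x, ‖x‖ ≤ 1 + η → jac α x = 0 := fun x hx ↦ by
    rw [hαj]
    refine hΦs _ ?_
    have := norm_sub_norm_le z x
    rw [norm_sub_rev] at this
    linarith
  have hβz : ∀ x, 1 - η ≤ ‖x‖ → jac β x = 0 := fun x hx ↦ by
    rw [hβj]
    refine hΦs _ ?_
    have := norm_sub_norm_le x y
    linarith
  have hth : ∀ x ∈ thickening η (sphere (0 : E) 1), jac α x = 0 ∧ jac β x = 0 := by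
    intro x hx
    obtain ⟨s, hs, hxs⟩ := mem_thickening_iff.1 hx
    rw [mem_sphere_zero_iff_norm] at hs
    rw [dist_eq_norm] at hxs
    have h1 := norm_sub_norm_le x s
    have h2 := norm_sub_norm_le s x
    rw [norm_sub_rev] at h2
    exact ⟨hαz x (by linarith), hβz x (by linarith)⟩
  set N := closedBall p R with hN
  have hnear : ∀ x ∉ N, α =ᶠ[𝓝 x] β := fun x hx ↦ by
    filter_upwards [isClosed_closedBall.isOpen_compl.mem_nhds hx] with w hw using hαβ w hw
  obtain ⟨G, hG, hGG₀⟩ := exists_contDiff_dist_lt_of_isCompact hG₀ hXc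
    (show 0 < η / 4 by positivity)
  have hGX : ∀ x ∈ X, G x ∈ thickening η (sphere (0 : E) 1) := by
    rintro _ ⟨x, hx, rfl⟩
    exact mem_thickening_iff.2 ⟨G₀ (f x), by simpa using hG₀1 x (by simpa using hx),
      (hGG₀ _ (mem_image_of_mem f hx)).trans (by linarith)⟩
  have hcap : ∀ x, ‖x‖ = 1 → dist (G₀ (f x)) p ≤ 2 * R → c < inner ℝ x p := by
    intro x hx hd
    by_contra! hxc
    exact ((hRO _ hd).2.trans_le (hG₀K x hx hxc)).false
  have hKO : X ∩ G ⁻¹' N ⊆ O := by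
    rintro _ ⟨⟨x, hx, rfl⟩, hxN⟩
    have h1 := hGG₀ _ (mem_image_of_mem f hx)
    rw [mem_preimage, hN, mem_closedBall] at hxN
    rw [mem_sphere_zero_iff_norm] at hx
    have h2 : dist (G₀ (f x)) p ≤ 2 * R := by
      linarith [dist_triangle_left (G₀ (f x)) p (G (f x))]
    have h3 := hcap x hx h2
    rw [hG₀D x hx h3.le] at h2
    exact (hRO x h2).1
  obtain ⟨χ, hχ, -, hχ1, hχ0⟩ := exists_smooth_cutoff
    (hXc.isClosed.inter (isClosed_closedBall.preimage hG.continuous)) hO hKO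
  set γ₀ : E → E := β ∘ G with hγ₀def
  set γ₁ : E → E := fun x ↦ β (G x) + χ x • (α (G x) - β (G x)) with hγ₁def
  have hγ₀ : ContDiff ℝ 1 γ₀ := hβ.comp hG
  have hγ₁ : ContDiff ℝ 1 γ₁ := hγ₀.add (hχ.smul ((hα.comp hG).sub hγ₀))
  have hγX : ∀ x ∈ X, γ₁ =ᶠ[𝓝 x] α ∘ G := by
    intro x hx
    by_cases hxN : G x ∈ N
    · filter_upwards [hχ1 x ⟨hx, hxN⟩] with w hw
      simp [hγ₁def, hw]
    · filter_upwards [hG.continuous.continuousAt.eventually (hnear _ hxN)] with w hw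
      simp [hγ₁def, hw]
  have hγO : ∀ x ∉ O, γ₁ =ᶠ[𝓝 x] γ₀ := by
    intro x hx
    filter_upwards [hχ0 x hx] with w hw
    simp [hγ₁def, hγ₀def, hw]
  set h : E → ℝ := fun x ↦ jac γ₁ x - jac γ₀ x with hh
  have hhc : Continuous h := (continuous_jac hγ₁).sub (continuous_jac hγ₀)
  have hhX : ∀ x ∈ X, h =ᶠ[𝓝 x] 0 := by
    intro x hx
    filter_upwards [(hγX x hx).eventuallyEq_nhds,
      hG.continuous.continuousAt.eventually (isOpen_thickening.mem_nhds (hGX x hx))] with w hw hw2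
    simp only [hh, jac_congr hw, hγ₀def, jac_comp hα hG, jac_comp hβ hG, (hth _ hw2).1,
      (hth _ hw2).2, zero_mul, sub_self, Pi.zero_apply]
  have hhO : ∀ x ∉ O, h =ᶠ[𝓝 x] 0 := by
    intro x hx
    filter_upwards [(hγO x hx).eventuallyEq_nhds] with w hw
    simp only [hh, jac_congr hw, sub_self, Pi.zero_apply]
  have htO : tsupport h ⊆ O := fun x hx ↦ by
    by_contra hxO
    exact notMem_tsupport_iff_eventuallyEq.2 (hhO x hxO) hx
  have htV : tsupport h ⊆ V := fun x hx ↦ by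
    refine hOV ⟨htO hx, fun hxX ↦ ?_⟩
    exact notMem_tsupport_iff_eventuallyEq.2 (hhX x hxX) hx
  have hhs : HasCompactSupport h :=
    isCompact_of_isClosed_isBounded (isClosed_tsupport h) (hOb.subset htO)
  have hhI : ∫ x, h x = 0 := by
    refine integral_jac_sub_jac_eq_zero hγ₁ hγ₀ (HasCompactSupport.intro hOb.isCompact_closure ?_)
    intro x hx
    rw [Pi.sub_apply, (hγO x fun h ↦ hx (subset_closure h)).eq_of_nhds, sub_self]
  obtain ⟨W, hWc, hWp, htW, hWV⟩ := hV.exists_isCompact_isPreconnected_superset hVc hhs htV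
  obtain ⟨δ₁, hδ₁, hδ₁d⟩ := (hVX.mono_left hWV).exists_thickenings hWc hXc.isClosed
  obtain ⟨δ₂, hδ₂, hδ₂s⟩ := hXc.exists_thickening_subset_open
    (isOpen_setOfPred_eventually_nhds (p := fun w ↦ γ₁ w = (α ∘ G) w)) hγX
  obtain ⟨δ₃, hδ₃, hδ₃G⟩ := hXc.exists_forall_dist_lt hG.continuous (show 0 < η / 4 by positivity)
  obtain ⟨F, hF, hFf⟩ := exists_contDiff_dist_lt_of_isCompact hf (isCompact_sphere (0 : E) 1)
    (show 0 < min δ₁ (min δ₂ δ₃) by positivity)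
  have hfrb : frontier (ball (0 : E) 1) = sphere 0 1 := frontier_ball _ one_ne_zero
  have hFth : ∀ δ, min δ₁ (min δ₂ δ₃) ≤ δ → ∀ x ∈ sphere (0 : E) 1, F x ∈ thickening δ X :=
    fun δ hδ x hx ↦ mem_thickening_iff.2 ⟨f x, mem_image_of_mem f hx, (hFf x hx).trans_le hδ⟩
  have hGF : ∀ x ∈ sphere (0 : E) 1, dist (G (F x)) (G₀ (f x)) < η / 2 := fun x hx ↦ by
    have h1 := hδ₃G _ (mem_image_of_mem f hx) (F x)
      ((hFf x hx).trans_le ((min_le_right _ _).trans (min_le_right _ _)))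
    have h2 := hGG₀ _ (mem_image_of_mem f hx)
    linarith [dist_triangle (G (F x)) (G (f x)) (G₀ (f x))]
  have hzero : ∫ x in ball (0 : E) 1, h (F x) * jac F x = 0 := by
    refine setIntegral_comp_mul_jac_eq_zero isOpen_ball isBounded_ball hF hhc hhs hhI hWp htW hδ₁
      fun w hw x hx ↦ ?_
    rw [hfrb] at hx
    by_contra! hlt
    exact disjoint_left.1 hδ₁d (mem_thickening_iff.2 ⟨w, hw, hlt⟩)
      (hFth δ₁ (min_le_left _ _) x hx)
  have htrans := setIntegral_jac_sub_jac_comp (A := ball (0 : E) 1)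
    (M := sphere (0 : E) 1 ∩ {x | c ≤ inner ℝ x p}) (K := sphere (0 : E) 1 ∩ {x | inner ℝ x p ≤ c})
    (N := N) isOpen_ball isBounded_ball
    (isClosed_sphere.inter (isClosed_le continuous_const (by fun_prop))) isClosed_closedBall
    (by
      rw [hfrb, ← inter_union_distrib_left]
      exact fun x hx ↦ ⟨hx, le_total c (inner ℝ x p)⟩)
    hα hβ (hG.comp hF) hη0 hαβ
    (fun x hx ↦ (hth x (thickening_subset_of_subset η inter_subset_left hx)).1)
    (fun x hx ↦ (hth x (thickening_subset_of_subset η inter_subset_left hx)).2)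
    (fun x hx hxN ↦ by
      obtain ⟨k, hk, hxk⟩ := mem_thickening_iff.1 hx
      rw [hN, mem_closedBall] at hxN
      have : dist k p ≤ 2 * R := by linarith [dist_triangle_left k p x]
      exact ((hRO k this).2.trans_le hk.2).false)
    (fun x hx ↦ by
      have := hGF x hx.1
      rwa [hG₀D x (by simpa using hx.1) hx.2] at this)
    (fun x hx hxN ↦ by
      have := hGF x hx.1
      rw [hN, mem_closedBall] at hxN
      refine ((hcap x (by simpa using hx.1) ?_).trans_le hx.2).false
      rw [Function.comp_apply] at hxN
      linarith [dist_triangle_left (G₀ (f x)) p (G (F x))])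
  have hL : ∫ x in ball (0 : E) 1, (jac α x - jac β x) = - ∫ x, jac Φ x := by
    have e : ∀ x ∈ ball (0 : E) 1, jac α x - jac β x = - jac Φ (x - y) := fun x hx ↦ by
      rw [hαz x (by linarith [mem_ball_zero_iff.1 hx]), hβj, zero_sub]
    rw [setIntegral_congr_fun measurableSet_ball e, integral_neg,
      setIntegral_eq_integral_of_forall_compl_eq_zero fun x hx ↦ ?_,
      integral_sub_right_eq_self (jac Φ) y]
    rw [mem_ball_zero_iff, not_lt] at hx
    rw [← hβj, hβz x (by linarith)]
  have hγ₁F : ContDiff ℝ 1 (γ₁ ∘ F) := hγ₁.comp hF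
  have hγ₀F : ContDiff ℝ 1 (γ₀ ∘ F) := hγ₀.comp hF
  have hαGF : ContDiff ℝ 1 (α ∘ (G ∘ F)) := hα.comp (hG.comp hF)
  have hRr : ∫ x in ball (0 : E) 1, (jac (α ∘ (G ∘ F)) x - jac (γ₀ ∘ F) x) = 0 := by
    rw [integral_sub (integrableOn_jac hαGF isBounded_ball) (integrableOn_jac hγ₀F isBounded_ball),
      setIntegral_jac_congr_frontier isOpen_ball isBounded_ball hαGF hγ₁F,
      ← integral_sub (integrableOn_jac hγ₁F isBounded_ball) (integrableOn_jac hγ₀F isBounded_ball),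
      ← hzero]
    · congr 1
      ext x
      rw [jac_comp hγ₁ hF, jac_comp hγ₀ hF, hh, sub_mul]
    · intro x hx
      rw [hfrb] at hx
      have h1 : ∀ᶠ w in 𝓝 (F x), γ₁ w = (α ∘ G) w :=
        hδ₂s (hFth δ₂ ((min_le_right _ _).trans (min_le_left _ _)) x hx)
      filter_upwards [hF.continuous.continuousAt.eventually h1] with w hw using hw.symm
  rw [hL] at htrans
  have : β ∘ (G ∘ F) = γ₀ ∘ F := rfl
  rw [this, hRr] at htrans
  linarith

end Separation

section TwoSides

variable {E : Type*} [NormedAddCommGroup E] [InnerProductSpace ℝ E] [FiniteDimensional ℝ E]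
  [Nontrivial E] [MeasurableSpace E] [BorelSpace E]

omit [Nontrivial E] [MeasurableSpace E] [BorelSpace E] in
/-- Smooth approximations of a partially inverse pair of maps between a sphere and its image. -/
lemma exists_contDiff_pair_on_cap {p : E} (hp : ‖p‖ = 1) {c : ℝ} (hc₁ : -1 < c)
    (hc₂ : c < 1) {f : E → E} (hf : Continuous f)
    (hinj : ∀ x, ‖x‖ = 1 → c ≤ inner ℝ x p → ∀ y, ‖y‖ = 1 → f y = f x → y = x) {R η : ℝ}
    (hR : ∀ x, ‖x‖ = 1 → inner ℝ x p ≤ c → 2 * R ≤ dist (f x) (f p)) (hη : 0 < η) (hηR : η ≤ R)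
    {T : Set E} (hT : IsCompact T) (hXT : f '' sphere 0 1 ⊆ T) :
    ∃ F G : E → E, ∃ τ : ℝ, 0 < τ ∧ ContDiff ℝ 1 F ∧ ContDiff ℝ 1 G ∧
      (∀ x, ‖x‖ = 1 → c ≤ inner ℝ x p → dist (F (G (f x))) (f x) < η / 2) ∧
      (∀ x, ‖x‖ = 1 → inner ℝ x p ≤ c → F (G (f x)) ∉ closedBall (f p) R) ∧
      (∀ x, 1 - 2 * τ ≤ ‖x‖ → ‖x‖ ≤ 2 → F x ∈ thickening η (f '' sphere 0 1)) ∧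
      (∀ x, ‖x‖ = 1 → 1 - τ ≤ ‖G (f x)‖) ∧ ∀ x ∈ T, ‖G x‖ ≤ 2 := by
  obtain ⟨G₀, hG₀, hG₀le, hG₀1, hG₀D, hG₀K⟩ :=
    exists_continuous_leftInverse_on_cap hp hc₁ hc₂ hf hinj
  set X := f '' sphere (0 : E) 1 with hX
  have hXc : IsCompact X := (isCompact_sphere _ _).image hf
  set F₀ : E → E := fun x ↦ f ((max 1 ‖x‖)⁻¹ • x) with hF₀def
  have hF₀ : Continuous F₀ := hf.comp <| Continuous.smul
    (Continuous.inv₀ (by fun_prop) fun x ↦ (zero_lt_one.trans_le (le_max_left 1 ‖x‖)).ne')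
    continuous_id
  have hF₀f : ∀ x, ‖x‖ = 1 → F₀ x = f x := fun x hx ↦ by simp [hF₀def, hx]
  have hF₀X : ∀ x, 1 ≤ ‖x‖ → F₀ x ∈ X := fun x hx ↦ by
    refine mem_image_of_mem f ?_
    rw [mem_sphere_zero_iff_norm, max_eq_right hx, norm_smul, norm_inv, norm_norm,
      inv_mul_cancel₀ (by linarith)]
  obtain ⟨δ₁, hδ₁, hδ₁F⟩ := (isCompact_sphere (0 : E) 1).exists_forall_dist_lt hF₀
    (show 0 < η / 2 by positivity)
  obtain ⟨δ₂, hδ₂, hδ₂F⟩ := (hXc.image hG₀).exists_forall_dist_lt hF₀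
    (show 0 < η / 4 by positivity)
  set τ := min (δ₁ / 4) (1 / 4) with hτ
  have hτ0 : 0 < τ := by positivity
  have hτδ : τ ≤ δ₁ / 4 := min_le_left _ _
  have hτ1 : τ ≤ 1 / 4 := min_le_right _ _
  obtain ⟨F, hF, hFF₀⟩ := exists_contDiff_dist_lt_of_isCompact hF₀ (isCompact_closedBall (0 : E) 2)
    (show 0 < η / 4 by positivity)
  obtain ⟨G, hG, hGG₀⟩ := exists_contDiff_dist_lt_of_isCompact hG₀ hT
    (show 0 < min δ₂ τ by positivity)
  have hGT : ∀ x ∈ T, ‖G x‖ ≤ 2 := fun x hx ↦ by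
    have h1 := (hGG₀ x hx).trans_le (min_le_right _ _)
    rw [dist_eq_norm] at h1
    linarith [norm_sub_norm_le (G x) (G₀ x), hG₀le x]
  have hFG : ∀ x, ‖x‖ = 1 → dist (F (G (f x))) (f (G₀ (f x))) < η / 2 := fun x hx ↦ by
    have hxX : f x ∈ X := mem_image_of_mem f (by simpa using hx)
    have h1 := hδ₂F _ (mem_image_of_mem G₀ hxX) (G (f x))
      ((hGG₀ _ (hXT hxX)).trans_le (min_le_left _ _))
    rw [hF₀f _ (hG₀1 x hx)] at h1
    have h2 := hFF₀ (G (f x)) (by simpa using hGT _ (hXT hxX))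
    linarith [dist_triangle (F (G (f x))) (F₀ (G (f x))) (f (G₀ (f x)))]
  refine ⟨F, G, τ, hτ0, hF, hG, fun x hx hxc ↦ ?_, fun x hx hxc hxN ↦ ?_, fun x hx1 hx2 ↦ ?_,
    fun x hx ↦ ?_, hGT⟩
  · have := hFG x hx
    rwa [hG₀D x hx hxc] at this
  · have h1 := hFG x hx
    have h2 := hR _ (hG₀1 x hx) (hG₀K x hx hxc)
    rw [mem_closedBall] at hxN
    linarith [dist_triangle_left (f (G₀ (f x))) (f p) (F (G (f x)))]
  · have h1 := hFF₀ x (by simpa using hx2)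
    rcases le_or_gt 1 ‖x‖ with hx | hx
    · exact mem_thickening_iff.2 ⟨_, hF₀X x hx, by linarith⟩
    have hx0 : ‖x‖ ≠ 0 := by linarith
    have hu : ‖‖x‖⁻¹ • x‖ = 1 := by rw [norm_smul, norm_inv, norm_norm, inv_mul_cancel₀ hx0]
    have h2 := hδ₁F (‖x‖⁻¹ • x) (by simpa using hu) x (by
      have e : x - ‖x‖⁻¹ • x = (1 - ‖x‖⁻¹) • x := by rw [sub_smul, one_smul]
      have e2 : |1 - ‖x‖⁻¹| * ‖x‖ = |‖x‖ - 1| := by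
        nth_rw 2 [← abs_norm x]
        rw [← abs_mul, sub_mul, inv_mul_cancel₀ hx0, one_mul]
      rw [dist_eq_norm, e, norm_smul, Real.norm_eq_abs, e2, abs_sub_comm, abs_of_pos (by linarith)]
      linarith)
    refine mem_thickening_iff.2 ⟨F₀ (‖x‖⁻¹ • x), hF₀X _ hu.ge, ?_⟩
    linarith [dist_triangle (F x) (F₀ x) (F₀ (‖x‖⁻¹ • x))]
  · have h1 := (hGG₀ (f x) (hXT (mem_image_of_mem f (by simpa using hx)))).trans_le
      (min_le_right _ _)
    rw [dist_comm, dist_eq_norm] at h1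
    linarith [norm_sub_norm_le (G₀ (f x)) (G (f x)), hG₀1 x hx]

/-- Integrals of differences of Jacobians over a domain bounded by the image of the sphere are
pulled back from the ball. -/
lemma exists_setIntegral_jac_sub_jac_eq {p : E} {c : ℝ} {f F G α β : E → E}
    (hf : Continuous f) (hF : ContDiff ℝ 1 F) (hG : ContDiff ℝ 1 G) (hα : ContDiff ℝ 1 α)
    (hβ : ContDiff ℝ 1 β) {R η τ : ℝ}
    (hR : ∀ x, ‖x‖ = 1 → inner ℝ x p ≤ c → 2 * R ≤ dist (f x) (f p)) (hη : 0 < η) (hηR : η ≤ R)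
    (hτ : 0 < τ)
    (hFG : ∀ x, ‖x‖ = 1 → c ≤ inner ℝ x p → dist (F (G (f x))) (f x) < η / 2)
    (hFGN : ∀ x, ‖x‖ = 1 → inner ℝ x p ≤ c → F (G (f x)) ∉ closedBall (f p) R)
    (hFX : ∀ x, 1 - 2 * τ ≤ ‖x‖ → ‖x‖ ≤ 2 → F x ∈ thickening η (f '' sphere 0 1))
    {T : Set E} (hGT : ∀ x ∈ T, ‖G x‖ ≤ 2) (hαβ : ∀ x ∉ closedBall (f p) R, α x = β x)
    (hαX : ∀ x ∈ thickening η (f '' sphere 0 1), jac α x = 0)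
    (hβX : ∀ x ∈ thickening η (f '' sphere 0 1), jac β x = 0) :
    ∃ J : E → ℝ, Continuous J ∧ HasCompactSupport J ∧ tsupport J ⊆ closedBall 0 (1 - 2 * τ) ∧
      ∀ A : Set E, IsOpen A → Bornology.IsBounded A → A ⊆ T → frontier A ⊆ f '' sphere 0 1 →
        ∫ x in A, (jac α x - jac β x) = ∫ x in A, J (G x) * jac G x := by
  obtain ⟨κ, hκ, -, hκ1, hκ0⟩ := exists_smooth_cutoff (isClosed_closedBall (x := (0 : E)) (ε := 1))
    (isOpen_ball (x := (0 : E)) (ε := 2)) (closedBall_subset_ball (by norm_num))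
  set h : E → ℝ := fun x ↦ jac (α ∘ F) x - jac (β ∘ F) x with hh
  have hαF : ContDiff ℝ 1 (α ∘ F) := hα.comp hF
  have hβF : ContDiff ℝ 1 (β ∘ F) := hβ.comp hF
  have hhc : Continuous h := (continuous_jac hαF).sub (continuous_jac hβF)
  have hh0 : ∀ x, 1 - 2 * τ ≤ ‖x‖ → ‖x‖ ≤ 2 → h x = 0 := fun x h1 h2 ↦ by
    simp only [hh, jac_comp hα hF, jac_comp hβ hF, hαX _ (hFX x h1 h2), hβX _ (hFX x h1 h2),
      zero_mul, sub_self]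
  have hJ0 : ∀ x ∉ closedBall (0 : E) (1 - 2 * τ), κ x * h x = 0 := fun x hx ↦ by
    rw [mem_closedBall_zero_iff, not_le] at hx
    rcases lt_or_ge ‖x‖ 2 with h2 | h2
    · rw [hh0 x hx.le h2.le, mul_zero]
    · rw [(hκ0 x (by simpa using h2)).eq_of_nhds, zero_mul]
  have hJh : ∀ x, ‖x‖ ≤ 2 → κ x * h x = h x := fun x hx ↦ by
    rcases le_or_gt ‖x‖ 1 with h1 | h1
    · rw [(hκ1 x (by simpa using h1)).eq_of_nhds, one_mul]
    · rw [hh0 x (by linarith) hx, mul_zero]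
  refine ⟨fun x ↦ κ x * h x, hκ.continuous.mul hhc,
    HasCompactSupport.intro (isCompact_closedBall _ _) hJ0,
    closure_minimal (fun x hx ↦ by_contra fun hxn ↦ hx (hJ0 x hxn)) isClosed_closedBall,
    fun A hA hb hAT hfr ↦ ?_⟩
  have hpc : Continuous fun x : E ↦ inner ℝ x p := by fun_prop
  rw [setIntegral_jac_sub_jac_comp (M := f '' (sphere (0 : E) 1 ∩ {x | c ≤ inner ℝ x p}))
    (K := f '' (sphere (0 : E) 1 ∩ {x | inner ℝ x p ≤ c})) hA hb
    (((isCompact_sphere (0 : E) 1).inter_right (isClosed_le continuous_const hpc)).image hf).isClosed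
    isClosed_closedBall (hfr.trans ?_) hα hβ (hF.comp hG) hη hαβ
    (fun x hx ↦ hαX x (thickening_subset_of_subset η (image_mono inter_subset_left) hx))
    (fun x hx ↦ hβX x (thickening_subset_of_subset η (image_mono inter_subset_left) hx))
    ?_ ?_ ?_]
  · refine setIntegral_congr_fun hA.measurableSet fun x hx ↦ ?_
    simp only
    rw [hJh _ (hGT x (hAT hx)), ← Function.comp_assoc, ← Function.comp_assoc, jac_comp hαF hG,
      jac_comp hβF hG, ← sub_mul]
  · rw [← image_union, ← inter_union_distrib_left]
    exact image_mono fun x hx ↦ ⟨hx, le_total c (inner ℝ x p)⟩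
  · intro x hx hxN
    obtain ⟨_, ⟨k, hk, rfl⟩, hxk⟩ := mem_thickening_iff.1 hx
    rw [mem_closedBall] at hxN
    have := hR k (by simpa using hk.1) hk.2
    linarith [dist_triangle_left (f k) (f p) x]
  · rintro _ ⟨x, hx, rfl⟩
    exact hFG x (by simpa using hx.1) hx.2
  · rintro _ ⟨x, hx, rfl⟩
    exact hFGN x (by simpa using hx.1) hx.2

/-- Near an injectively embedded piece of the image of a sphere, there are no three pairwise
separated parts of the complement of the image, two of which are bounded. -/
lemma exists_isOpen_not_three_sides {p : E} (hp : ‖p‖ = 1) {c : ℝ} (hc₁ : -1 < c)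
    (hc₂ : c < 1) {f : E → E} (hf : Continuous f)
    (hinj : ∀ x, ‖x‖ = 1 → c ≤ inner ℝ x p → ∀ y, ‖y‖ = 1 → f y = f x → y = x) :
    ∃ O, IsOpen O ∧ f p ∈ O ∧ ∀ A B : Set E, IsOpen A → IsOpen B → Bornology.IsBounded A →
      Bornology.IsBounded B → Disjoint A B → Disjoint A (f '' sphere 0 1) →
      Disjoint B (f '' sphere 0 1) → frontier A ⊆ f '' sphere 0 1 →
      frontier B ⊆ f '' sphere 0 1 → ∀ a ∈ O ∩ A, ∀ b ∈ O ∩ B,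
      O ⊆ A ∪ B ∪ f '' sphere 0 1 := by
  set X := f '' sphere (0 : E) 1 with hX
  have hXc : IsCompact X := (isCompact_sphere _ _).image hf
  have hpc : Continuous fun x : E ↦ inner ℝ x p := by fun_prop
  have hpp : inner ℝ p p = (1 : ℝ) := by rw [real_inner_self_eq_norm_sq, hp, one_pow]
  have hKc : IsCompact (f '' (sphere (0 : E) 1 ∩ {x | inner ℝ x p ≤ c})) :=
    ((isCompact_sphere (0 : E) 1).inter_right (isClosed_le hpc continuous_const)).image hf
  have hpK : f p ∉ f '' (sphere (0 : E) 1 ∩ {x | inner ℝ x p ≤ c}) := by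
    rintro ⟨x, hx, hxp⟩
    have hxp' : x = p := hinj p hp (by rw [hpp]; exact hc₂.le) x (by simpa using hx.1) hxp
    have := hx.2
    rw [hxp', mem_ofPred_eq, hpp] at this
    exact hc₂.not_ge this
  obtain ⟨R', hR', hR'K⟩ := Metric.isOpen_iff.1 hKc.isClosed.isOpen_compl _ hpK
  set R := R' / 2 with hRdef
  have hR0 : 0 < R := by positivity
  have hR : ∀ x, ‖x‖ = 1 → inner ℝ x p ≤ c → 2 * R ≤ dist (f x) (f p) := fun x hx hxc ↦ by
    by_contra! hlt
    exact hR'K (mem_ball.2 (by linarith)) (mem_image_of_mem f ⟨by simpa using hx, hxc⟩)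
  refine ⟨ball (f p) (R / 8), isOpen_ball, mem_ball_self (by positivity), ?_⟩
  rintro A B hA hB hAb hBb hAB hAX hBX hAf hBf a ⟨haO, haA⟩ b ⟨hbO, hbB⟩ z hzO
  by_contra hz
  rw [mem_union, mem_union, not_or, not_or] at hz
  obtain ⟨⟨hzA, hzB⟩, hzX⟩ := hz
  have hclA : closure A ⊆ A ∪ X := fun x hx ↦ by
    by_contra! h
    rw [mem_union, not_or] at h
    exact h.2 (hAf ⟨hx, fun h' ↦ h.1 (interior_subset h')⟩)
  have hclB : closure B ⊆ B ∪ X := fun x hx ↦ by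
    by_contra! h
    rw [mem_union, not_or] at h
    exact h.2 (hBf ⟨hx, fun h' ↦ h.1 (interior_subset h')⟩)
  have hzo : z ∈ (closure A ∪ closure B ∪ X)ᶜ := by
    rintro ((h | h) | h)
    · exact (hclA h).elim hzA hzX
    · exact (hclB h).elim hzB hzX
    · exact hzX h
  have hball : ∀ {U : Set E} {s : E}, IsOpen U → s ∈ U → ∀ᶠ η in 𝓝[>] (0 : ℝ), ball s (2 * η) ⊆ U := by
    intro U s hU hs
    obtain ⟨ε, hε, hεU⟩ := Metric.isOpen_iff.1 hU s hs
    filter_upwards [Ioo_mem_nhdsGT (show 0 < ε / 2 by positivity)] with η hη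
    exact (ball_subset_ball (by linarith [hη.2])).trans hεU
  obtain ⟨η, ⟨⟨⟨hηa, hηb⟩, hηz⟩, hηR⟩, hη⟩ := ((((hball hA haA).and (hball hB hbB)).and
    (hball ((isClosed_closure.union isClosed_closure).union hXc.isClosed).isOpen_compl hzo)).and
    (Ioo_mem_nhdsGT (show 0 < R / 8 by positivity))).and self_mem_nhdsWithin |>.exists
  obtain ⟨hη, hηR⟩ := hηR
  obtain ⟨Φ, hΦ, hΦ0, hΦs, hΦc, hΦI⟩ := exists_jac_bump (E := E) hη
  have hΦs' : ∀ x, R / 8 ≤ ‖x‖ → jac Φ x = 0 := fun x hx ↦ hΦs x (by linarith)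
  obtain ⟨αb, hαb, hαbj, hαbβ⟩ := exists_jac_bump_shift hR0 haO hbO hΦ hΦs'
  obtain ⟨αz, hαz, hαzj, hαzβ⟩ := exists_jac_bump_shift hR0 haO hzO hΦ hΦs'
  set β : E → E := fun x ↦ Φ (x - a) with hβdef
  have hβ : ContDiff ℝ 1 β := hΦ.comp (contDiff_id.sub contDiff_const)
  have hβj : ∀ x, jac β x = jac Φ (x - a) := fun x ↦ jac_comp_sub Φ hΦ a x
  have hvan : ∀ s, Disjoint (ball s (2 * η)) X → ∀ x ∈ thickening η X, jac Φ (x - s) = 0 := by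
    intro s hs x hx
    refine hΦs _ ?_
    by_contra! hlt
    obtain ⟨y, hy, hxy⟩ := mem_thickening_iff.1 hx
    refine disjoint_left.1 hs (mem_ball.2 ?_) hy
    rw [← dist_eq_norm] at hlt
    linarith [dist_triangle_left y s x]
  have hbX : Disjoint (ball b (2 * η)) X := hBX.mono_left hηb
  have haX : Disjoint (ball a (2 * η)) X := hAX.mono_left hηa
  have hzd := disjoint_compl_left.mono_left hηz
  have hzXd : Disjoint (ball z (2 * η)) X := hzd.mono_right subset_union_right
  have hJc : Continuous (jac Φ) := continuous_jac hΦ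
  have hin : ∀ {U : Set E} {s : E}, ball s (2 * η) ⊆ U → ∫ x in U, jac Φ (x - s) = ∫ x, jac Φ x := by
    intro U s hs
    rw [setIntegral_eq_integral_of_forall_compl_eq_zero fun x hx ↦ ?_,
      integral_sub_right_eq_self (jac Φ) s]
    refine hΦs _ ?_
    by_contra! hlt
    rw [← dist_eq_norm] at hlt
    exact hx (hs (mem_ball.2 (by linarith)))
  have hout : ∀ {U : Set E} {s : E}, Disjoint (ball s (2 * η)) U → ∫ x in U, jac Φ (x - s) = 0 := by
    intro U s hs
    refine setIntegral_eq_zero_of_forall_eq_zero fun x hx ↦ hΦs _ ?_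
    by_contra! hlt
    rw [← dist_eq_norm] at hlt
    exact disjoint_left.1 hs (mem_ball.2 (by linarith)) hx
  have hintgr : ∀ {U : Set E} {g : E → ℝ}, Bornology.IsBounded U → Continuous g →
      IntegrableOn g U := fun hU hg ↦
    (hg.locallyIntegrable.integrableOn_isCompact hU.isCompact_closure).mono_set subset_closure
  have hval : ∀ {U : Set E} {s : E} {α : E → E}, Bornology.IsBounded U →
      (∀ x, jac α x = jac Φ (x - s)) → ∫ x in U, (jac α x - jac β x) =
        (∫ x in U, jac Φ (x - s)) - ∫ x in U, jac Φ (x - a) := by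
    intro U s α hU hα
    rw [← integral_sub (hintgr hU (by fun_prop)) (hintgr hU (by fun_prop))]
    simp only [hα, hβj]
  set T := closure A ∪ closure B ∪ X with hT
  obtain ⟨F, G, τ, hτ, hF, hG, hFG, hFGN, hFX, hGX, hGT⟩ := exists_contDiff_pair_on_cap hp hc₁ hc₂
    hf hinj hR hη (by linarith) ((hAb.isCompact_closure.union hBb.isCompact_closure).union hXc)
    subset_union_right
  have hAT : A ⊆ T := subset_closure.trans (subset_union_left.trans subset_union_left)
  have hBT : B ⊆ T := subset_closure.trans (subset_union_right.trans subset_union_left)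
  have hβX : ∀ x ∈ thickening η X, jac β x = 0 := fun x hx ↦ (hβj x).trans (hvan a haX x hx)
  obtain ⟨Jb, hJb, hJbs, hJbV, hJbI⟩ := exists_setIntegral_jac_sub_jac_eq hf hF hG hαb hβ hR hη
    (by linarith) hτ hFG hFGN hFX hGT hαbβ (fun x hx ↦ (hαbj x).trans (hvan b hbX x hx)) hβX
  obtain ⟨Jz, hJz, hJzs, hJzV, hJzI⟩ := exists_setIntegral_jac_sub_jac_eq hf hF hG hαz hβ hR hη
    (by linarith) hτ hFG hFGN hFX hGT hαzβ (fun x hx ↦ (hαzj x).trans (hvan z hzXd x hx)) hβX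
  set m := ∫ x, jac Φ x with hm
  have hAb' : ∫ x in A, Jb (G x) * jac G x = -m := by
    rw [← hJbI A hA hAb hAT hAf, hval hAb hαbj, hin hηa, hout (hAB.symm.mono_left hηb), zero_sub]
  have hAz' : ∫ x in A, Jz (G x) * jac G x = -m := by
    rw [← hJzI A hA hAb hAT hAf, hval hAb hαzj, hin hηa, hout (hzd.mono_right hAT), zero_sub]
  have hBb' : ∫ x in B, Jb (G x) * jac G x = m := by
    rw [← hJbI B hB hBb hBT hBf, hval hBb hαbj, hin hηb, hout (hAB.mono_left hηa), sub_zero]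
  have hBz' : ∫ x in B, Jz (G x) * jac G x = 0 := by
    rw [← hJzI B hB hBb hBT hBf, hval hBb hαzj, hout (hzd.mono_right hBT),
      hout (hAB.mono_left hηa), sub_zero]
  have hzero : ∀ {U : Set E} (s t : ℝ), IsOpen U → Bornology.IsBounded U → frontier U ⊆ X →
      s * (∫ x, Jb x) + t * (∫ x, Jz x) = 0 →
      s * (∫ x in U, Jb (G x) * jac G x) + t * (∫ x in U, Jz (G x) * jac G x) = 0 := by
    intro U s t hU hUb hUf hst
    have hGc := hG.continuous
    have hGj := continuous_jac hG
    have h := setIntegral_comp_mul_jac_eq_zero hU hUb hG (J := fun x ↦ s * Jb x + t * Jz x)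
      (by fun_prop) (HasCompactSupport.add hJbs.mul_left hJzs.mul_left) (by
        rw [integral_add ((hJb.integrable_of_hasCompactSupport hJbs).const_mul s)
          ((hJz.integrable_of_hasCompactSupport hJzs).const_mul t), integral_const_mul,
          integral_const_mul, hst])
      (convex_closedBall (0 : E) (1 - 2 * τ)).isPreconnected ?_ hτ ?_
    · rw [← h, ← integral_const_mul, ← integral_const_mul,
        ← integral_add (hintgr hUb (by fun_prop)) (hintgr hUb (by fun_prop))]
      congr 1
      ext x
      ring
    · refine closure_minimal (fun x hx ↦ ?_) isClosed_closedBall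
      by_contra hxn
      refine hx ?_
      simp only [image_eq_zero_of_notMem_tsupport fun h ↦ hxn (hJbV h),
        image_eq_zero_of_notMem_tsupport fun h ↦ hxn (hJzV h), mul_zero, add_zero]
    · intro y hy x hx
      obtain ⟨v, hv, rfl⟩ := hUf hx
      have := hGX v (by simpa using hv)
      rw [mem_closedBall_zero_iff] at hy
      rw [dist_eq_norm]
      linarith [norm_sub_norm_le (G (f v)) y]
  have e1 := hzero (∫ x, Jz x) (-∫ x, Jb x) hA hAb hAf (by ring)
  have e2 := hzero (∫ x, Jz x) (-∫ x, Jb x) hB hBb hBf (by ring)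
  rw [hAb', hAz'] at e1
  rw [hBb', hBz', mul_zero, add_zero] at e2
  have hIz : ∫ x, Jz x = 0 := (mul_eq_zero.1 e2).resolve_right hΦI.ne'
  rw [hIz, zero_mul, zero_add] at e1
  have hIb : ∫ x, Jb x = 0 := by
    rcases mul_eq_zero.1 e1 with h | h
    · linarith
    · linarith
  have e3 := hzero 1 0 hA hAb hAf (by rw [hIb]; ring)
  rw [hAb'] at e3
  linarith

end TwoSides

section ConnComp

variable {α : Type*} [TopologicalSpace α] {S C D : Set α}

lemma IsConnCompIn.subset (h : IsConnCompIn S C) : C ⊆ S := by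
  obtain ⟨x, -, rfl⟩ := h
  exact connectedComponentIn_subset S x

lemma IsConnCompIn.nonempty (h : IsConnCompIn S C) : C.Nonempty := by
  obtain ⟨x, hx, rfl⟩ := h
  exact ⟨x, mem_connectedComponentIn hx⟩

lemma IsConnCompIn.isPreconnected (h : IsConnCompIn S C) : IsPreconnected C := by
  obtain ⟨x, -, rfl⟩ := h
  exact isPreconnected_connectedComponentIn

lemma IsConnCompIn.eq_of_mem (hC : IsConnCompIn S C) (hD : IsConnCompIn S D) {x : α}
    (hxC : x ∈ C) (hxD : x ∈ D) : C = D := by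
  obtain ⟨y, -, rfl⟩ := hC
  obtain ⟨z, -, rfl⟩ := hD
  rw [connectedComponentIn_eq hxC, connectedComponentIn_eq hxD]

lemma IsConnCompIn.disjoint (hC : IsConnCompIn S C) (hD : IsConnCompIn S D) (hne : C ≠ D) :
    Disjoint C D :=
  disjoint_left.2 fun _ hxC hxD ↦ hne (hC.eq_of_mem hD hxC hxD)

lemma exists_isConnCompIn_mem {x : α} (hx : x ∈ S) : ∃ C, IsConnCompIn S C ∧ x ∈ C :=
  ⟨_, ⟨x, hx, rfl⟩, mem_connectedComponentIn hx⟩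

lemma IsConnCompIn.isOpen [LocallyConnectedSpace α] (h : IsConnCompIn S C) (hS : IsOpen S) :
    IsOpen C := by
  obtain ⟨x, -, rfl⟩ := h
  exact hS.connectedComponentIn

lemma IsConnCompIn.frontier_subset [LocallyConnectedSpace α] (h : IsConnCompIn S C)
    (hS : IsOpen S) : frontier C ⊆ Sᶜ := by
  intro x hx hxS
  obtain ⟨D, hD, hxD⟩ := exists_isConnCompIn_mem hxS
  obtain ⟨y, hyD, hyC⟩ := mem_closure_iff.1 hx.1 D (hD.isOpen hS) hxD
  rw [hD.eq_of_mem h hyD hyC] at hxD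
  rw [(h.isOpen hS).frontier_eq] at hx
  exact hx.2 hxD

end ConnComp

section Sphere

lemma inner_coe_sphere_eq {E : Type*} [NormedAddCommGroup E] [InnerProductSpace ℝ E]
    (x y : sphere (0 : E) 1) : inner ℝ (x : E) y = 1 - dist x y ^ 2 / 2 := by
  have h := norm_sub_sq_real (x : E) y
  rw [norm_eq_of_mem_sphere, norm_eq_of_mem_sphere, ← dist_eq_norm, ← Subtype.dist_eq] at h
  linarith

lemma isPreconnected_sphere_cap {E : Type*} [NormedAddCommGroup E] [InnerProductSpace ℝ E]
    (x₀ : sphere (0 : E) 1) {r : ℝ} (hr : 0 < r) (hr1 : r < 1) :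
    IsPreconnected {x | dist x x₀ < r} := by
  rw [← Topology.IsInducing.subtypeVal.isPreconnected_image]
  set c := 1 - r ^ 2 / 2 with hc
  have hc0 : 0 ≤ c := by nlinarith
  have key : ∀ x : sphere (0 : E) 1, dist x x₀ < r ↔ c < inner ℝ (x : E) x₀ := fun x ↦ by
    rw [inner_coe_sphere_eq, ← sq_lt_sq₀ dist_nonneg hr.le]
    constructor <;> intro h <;> linarith
  set P : Set E := {y | c * ‖y‖ < inner ℝ y (x₀ : E)} with hP
  have hPc : Convex ℝ P := by
    intro y hy z hz s t hs ht hst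
    simp only [hP, mem_ofPred_eq] at hy hz ⊢
    rw [inner_add_left, real_inner_smul_left, real_inner_smul_left]
    have h1 : ‖s • y + t • z‖ ≤ s * ‖y‖ + t * ‖z‖ := (norm_add_le _ _).trans_eq (by
      rw [norm_smul, norm_smul, Real.norm_of_nonneg hs, Real.norm_of_nonneg ht])
    have h2 := mul_le_mul_of_nonneg_left h1 hc0
    rcases hs.eq_or_lt with rfl | hs'
    · have : t = 1 := by linarith
      subst this
      linarith
    · nlinarith
  have hP0 : ∀ y ∈ P, ‖y‖ ≠ 0 := fun y hy h ↦ by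
    rw [norm_eq_zero] at h
    simp [hP, h] at hy
  have himg : Subtype.val '' {x | dist x x₀ < r} = (fun y : E ↦ ‖y‖⁻¹ • y) '' P := by
    ext y
    constructor
    · rintro ⟨x, hx, rfl⟩
      refine ⟨x, ?_, by simp⟩
      simpa [hP] using (key x).1 hx
    · rintro ⟨y, hy, rfl⟩
      have hn : ‖‖y‖⁻¹ • y‖ = 1 := by rw [norm_smul, norm_inv, norm_norm, inv_mul_cancel₀ (hP0 y hy)]
      refine ⟨⟨‖y‖⁻¹ • y, by simpa using hn⟩, (key _).2 ?_, rfl⟩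
      have hpos : 0 < ‖y‖ := (norm_nonneg y).lt_of_ne' (hP0 y hy)
      simp only [real_inner_smul_left]
      rw [← div_eq_inv_mul, lt_div_iff₀ hpos]
      exact hy
  rw [himg]
  exact hPc.isPreconnected.image _ (ContinuousOn.smul
    (continuous_norm.continuousOn.inv₀ hP0) continuousOn_id)

variable {n : ℕ}

lemma exists_sphere_punctured_chart (v : sphere (0 : EuclideanSpace ℝ (Fin (n + 2))) 1) :
    ∃ (φ : sphere (0 : EuclideanSpace ℝ (Fin (n + 2))) 1 → EuclideanSpace ℝ (Fin (n + 1)))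
      (ψ : EuclideanSpace ℝ (Fin (n + 1)) → sphere (0 : EuclideanSpace ℝ (Fin (n + 2))) 1),
      ContinuousOn φ {v}ᶜ ∧ Continuous ψ ∧ (∀ x, φ (ψ x) = x) ∧ (∀ x, ψ x ≠ v) ∧
        ∀ y, y ≠ v → ψ (φ y) = y := by
  have : Fact (Module.finrank ℝ (EuclideanSpace ℝ (Fin (n + 2))) = (n + 1) + 1) := ⟨by simp⟩
  have hs := stereographic'_source (n := n + 1) v
  have ht := stereographic'_target (n := n + 1) v
  set e := stereographic' (n + 1) v
  refine ⟨e, e.symm, hs ▸ e.continuousOn, ?_, fun x ↦ e.right_inv (by simp [ht]), fun x hx ↦ ?_,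
    fun y hy ↦ e.left_inv (by simpa [hs] using hy)⟩
  · have := e.continuousOn_symm
    rwa [ht, continuousOn_univ] at this
  · have := e.map_target (show x ∈ e.target by simp [ht])
    rw [hs] at this
    exact this hx

instance : LocallyConnectedSpace (sphere (0 : EuclideanSpace ℝ (Fin (n + 2))) 1) := by
  have : Fact (Module.finrank ℝ (EuclideanSpace ℝ (Fin (n + 2))) = (n + 1) + 1) := ⟨by simp⟩
  exact ChartedSpace.locallyConnectedSpace (EuclideanSpace ℝ (Fin (n + 1))) _

variable {f : sphere (0 : EuclideanSpace ℝ (Fin (n + 1))) 1 →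
  sphere (0 : EuclideanSpace ℝ (Fin (n + 2))) 1}
  {x₀ p : sphere (0 : EuclideanSpace ℝ (Fin (n + 1))) 1} {r : ℝ}

/-- A map between spheres, read in a chart of the target missing a point outside the image, and
extended to the whole Euclidean space containing the source. -/
lemma exists_euclidean_model (hf : Continuous f) (hr : r < 1)
    (hinj : ∀ p, dist p x₀ ≤ r → ∀ q, f q = f p → q = p) (hp : dist p x₀ < r)
    {v : sphere (0 : EuclideanSpace ℝ (Fin (n + 2))) 1} (hv : v ∉ range f) :
    ∃ (g : EuclideanSpace ℝ (Fin (n + 1)) → EuclideanSpace ℝ (Fin (n + 1))) (c : ℝ)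
      (φ : sphere (0 : EuclideanSpace ℝ (Fin (n + 2))) 1 → EuclideanSpace ℝ (Fin (n + 1)))
      (ψ : EuclideanSpace ℝ (Fin (n + 1)) → sphere (0 : EuclideanSpace ℝ (Fin (n + 2))) 1),
      Continuous g ∧ -1 < c ∧ c < 1 ∧
      (∀ x, ‖x‖ = 1 → c ≤ inner ℝ x (p : EuclideanSpace ℝ (Fin (n + 1))) → ∀ y, ‖y‖ = 1 →
        g y = g x → y = x) ∧
      ContinuousOn φ {v}ᶜ ∧ Continuous ψ ∧ (∀ x, φ (ψ x) = x) ∧ (∀ x, ψ x ≠ v) ∧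
      (∀ y, y ≠ v → ψ (φ y) = y) ∧ ψ (g p) = f p ∧ g '' sphere 0 1 = ψ ⁻¹' range f := by
  obtain ⟨φ, ψ, hφ, hψ, hφψ, hψv, hψφ⟩ := exists_sphere_punctured_chart v
  have hfv : ∀ x, f x ≠ v := fun x hx ↦ hv ⟨x, hx⟩
  have hφf : Continuous fun x ↦ φ (f x) := hφ.comp_continuous hf hfv
  have hdom : ∃ g₀ : EuclideanSpace ℝ (Fin (n + 1)) → EuclideanSpace ℝ (Fin (n + 1)),
      ContinuousOn g₀ (sphere 0 1) ∧ ∀ x : sphere (0 : EuclideanSpace ℝ (Fin (n + 1))) 1,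
        g₀ x = φ (f x) := by
    classical
    refine ⟨fun x ↦ if h : x ∈ sphere 0 1 then φ (f ⟨x, h⟩) else 0, ?_, fun x ↦ dif_pos x.2⟩
    rw [continuousOn_iff_continuous_domRestrict]
    convert hφf using 1
    ext1 x
    exact dif_pos x.2
  obtain ⟨g₀, hg₀, hg₀f⟩ := hdom
  obtain ⟨g, hg, hgg₀⟩ := exists_continuous_eqOn isClosed_sphere hg₀
  have hgf : ∀ x : sphere (0 : EuclideanSpace ℝ (Fin (n + 1))) 1, ψ (g x) = f x := fun x ↦ by
    rw [hgg₀ x.2, hg₀f, hψφ _ (hfv x)]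
  set s := r - dist p x₀ with hs
  have hs0 : 0 < s := sub_pos.2 hp
  have hs1 : s < 1 := by linarith [dist_nonneg (x := p) (y := x₀)]
  refine ⟨g, 1 - s ^ 2 / 2, φ, ψ, hg, by nlinarith, by nlinarith, fun x hx hxc y hy hxy ↦ ?_, hφ,
    hψ, hφψ, hψv, hψφ, hgf p, ?_⟩
  · lift x to sphere (0 : EuclideanSpace ℝ (Fin (n + 1))) 1 using by simpa using hx
    lift y to sphere (0 : EuclideanSpace ℝ (Fin (n + 1))) 1 using by simpa using hy
    rw [inner_coe_sphere_eq] at hxc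
    have hd : dist x p ≤ s := (sq_le_sq₀ dist_nonneg hs0.le).1 (by linarith)
    rw [hinj x (by linarith [dist_triangle x p x₀]) y (by rw [← hgf, ← hgf, hxy])]
  · ext x
    constructor
    · rintro ⟨y, hy, rfl⟩
      exact ⟨⟨y, hy⟩, (hgf ⟨y, hy⟩).symm⟩
    · rintro ⟨y, hy⟩
      exact ⟨y, y.2, by rw [← hφψ (g y), hgf, hy, hφψ]⟩

lemma not_diff_range_subset (hf : Continuous f) (hr : r < 1)
    (hinj : ∀ p, dist p x₀ ≤ r → ∀ q, f q = f p → q = p) (hp : dist p x₀ < r)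
    {v : sphere (0 : EuclideanSpace ℝ (Fin (n + 2))) 1} (hv : v ∉ range f)
    {O C : Set (sphere (0 : EuclideanSpace ℝ (Fin (n + 2))) 1)} (hO : IsOpen O) (hpO : f p ∈ O)
    (hC : IsConnCompIn (range f)ᶜ C) (hvC : v ∉ C) : ¬ O \ range f ⊆ C := by
  obtain ⟨g, c, φ, ψ, hg, hc₁, hc₂, hgi, hφ, hψ, hφψ, hψv, hψφ, hgp, hgX⟩ :=
    exists_euclidean_model hf hr hinj hp hv
  have hXo : IsOpen (range f)ᶜ := (isCompact_range hf).isClosed.isOpen_compl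
  intro hOC
  refine not_diff_image_sphere_subset (norm_eq_of_mem_sphere p) hc₁ hc₂ hg hgi (hO.preimage hψ)
    (by rwa [mem_preimage, hgp]) (V := ψ ⁻¹' C) ((hC.isOpen hXo).preimage hψ) ?_ ?_ ?_
  · have : ψ ⁻¹' C = φ '' C := by
      ext x
      constructor
      · exact fun hx ↦ ⟨ψ x, hx, hφψ x⟩
      · rintro ⟨y, hy, rfl⟩
        rwa [mem_preimage, hψφ y fun h ↦ hvC (h ▸ hy)]
    rw [this]
    exact hC.isPreconnected.image φ (hφ.mono fun y hy h ↦ hvC (by rwa [← show y = v from h]))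
  · rw [hgX]
    exact (disjoint_compl_left.mono_left hC.subset).preimage ψ
  · rw [hgX, ← preimage_sdiff]
    exact preimage_mono hOC

lemma exists_isOpen_subset_union_range (hf : Continuous f) (hr : r < 1)
    (hinj : ∀ p, dist p x₀ ≤ r → ∀ q, f q = f p → q = p) (hp : dist p x₀ < r)
    {U : Set (sphere (0 : EuclideanSpace ℝ (Fin (n + 2))) 1)} (hU : IsConnCompIn (range f)ᶜ U) :
    ∃ O, IsOpen O ∧ f p ∈ O ∧ ∀ A B, IsConnCompIn (range f)ᶜ A → IsConnCompIn (range f)ᶜ B →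
      A ≠ B → A ≠ U → B ≠ U → (O ∩ A).Nonempty → (O ∩ B).Nonempty → O ⊆ A ∪ B ∪ range f := by
  obtain ⟨v, hvU⟩ := hU.nonempty
  have hv := hU.subset hvU
  obtain ⟨g, c, φ, ψ, hg, hc₁, hc₂, hgi, hφ, hψ, hφψ, hψv, hψφ, hgp, hgX⟩ :=
    exists_euclidean_model hf hr hinj hp hv
  have hXo : IsOpen (range f)ᶜ := (isCompact_range hf).isClosed.isOpen_compl
  obtain ⟨O, hO, hpO, hOAB⟩ :=
    exists_isOpen_not_three_sides (norm_eq_of_mem_sphere p) hc₁ hc₂ hg hgi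
  have hpv : f p ≠ v := fun h ↦ hv ⟨p, h⟩
  have hφp : φ (f p) = g p := by rw [← hgp, hφψ]
  have hO' : IsOpen ({v}ᶜ ∩ φ ⁻¹' O) := hφ.isOpen_inter_preimage isOpen_compl_singleton hO
  refine ⟨{v}ᶜ ∩ φ ⁻¹' O, hO', ⟨hpv, by rwa [mem_preimage, hφp]⟩, ?_⟩
  rintro A B hA hB hAB hAU hBU ⟨a, ⟨hav, haO⟩, haA⟩ ⟨b, ⟨hbv, hbO⟩, hbB⟩
  have hbd : ∀ C, IsConnCompIn (range f)ᶜ C → C ≠ U → Bornology.IsBounded (ψ ⁻¹' C) := by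
    intro C hC hCU
    have hcpt : IsCompact (φ '' Uᶜ) := ((hU.isOpen hXo).isClosed_compl.isCompact).image_of_continuousOn
      (hφ.mono fun y hy h ↦ hy (by rwa [show y = v from h]))
    refine hcpt.isBounded.subset fun x hx ↦ ⟨ψ x, disjoint_left.1 (hC.disjoint hU hCU) hx, hφψ x⟩
  have hdX : ∀ C, IsConnCompIn (range f)ᶜ C → Disjoint (ψ ⁻¹' C) (g '' sphere 0 1) := by
    intro C hC
    rw [hgX]
    exact (disjoint_compl_left.mono_left hC.subset).preimage ψ
  have hfr : ∀ C, IsConnCompIn (range f)ᶜ C → frontier (ψ ⁻¹' C) ⊆ g '' sphere 0 1 := by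
    intro C hC
    rw [hgX]
    refine (hψ.frontier_preimage_subset C).trans (preimage_mono ?_)
    simpa using hC.frontier_subset hXo
  have h := hOAB (ψ ⁻¹' A) (ψ ⁻¹' B) ((hA.isOpen hXo).preimage hψ) ((hB.isOpen hXo).preimage hψ)
    (hbd A hA hAU) (hbd B hB hBU) ((hA.disjoint hB hAB).preimage ψ) (hdX A hA) (hdX B hB)
    (hfr A hA) (hfr B hB) (φ a) ⟨haO, by rwa [mem_preimage, hψφ a hav]⟩ (φ b)
    ⟨hbO, by rwa [mem_preimage, hψφ b hbv]⟩
  rw [hgX] at h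
  rintro y ⟨hyv, hyO⟩
  have hy := h hyO
  rwa [← preimage_union, ← preimage_union, mem_preimage, hψφ y hyv] at hy

/-- Locally at the image of an injectivity ball, the complement of the image has exactly two
sides. -/
lemma exists_isOpen_two_sides (hf : Continuous f) (hr : r < 1)
    (hinj : ∀ p, dist p x₀ ≤ r → ∀ q, f q = f p → q = p)
    {U₁ U₂ : Set (sphere (0 : EuclideanSpace ℝ (Fin (n + 2))) 1)}
    (hU₁ : IsConnCompIn (range f)ᶜ U₁) (hU₂ : IsConnCompIn (range f)ᶜ U₂) (hne : U₁ ≠ U₂)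
    (hp : dist p x₀ < r) :
    ∃ O A B, IsOpen O ∧ f p ∈ O ∧ IsConnCompIn (range f)ᶜ A ∧ IsConnCompIn (range f)ᶜ B ∧ A ≠ B ∧
      O \ range f ⊆ A ∪ B ∧ f p ∈ closure A ∧ f p ∈ closure B := by
  have hnot : ∀ O C, IsOpen O → f p ∈ O → IsConnCompIn (range f)ᶜ C → ¬ O \ range f ⊆ C := by
    intro O C hO hpO hC
    obtain ⟨v₁, hv₁⟩ := hU₁.nonempty
    obtain ⟨v₂, hv₂⟩ := hU₂.nonempty
    by_cases h : v₁ ∈ C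
    · exact not_diff_range_subset hf hr hinj hp (hU₂.subset hv₂) hO hpO hC fun h₂ ↦
        hne ((hU₁.eq_of_mem hC hv₁ h).trans (hC.eq_of_mem hU₂ h₂ hv₂))
    · exact not_diff_range_subset hf hr hinj hp (hU₁.subset hv₁) hO hpO hC h
  obtain ⟨O, hO, hpO, hOAB⟩ := exists_isOpen_subset_union_range hf hr hinj hp hU₁
  have hfin : ∀ A B, IsConnCompIn (range f)ᶜ A → IsConnCompIn (range f)ᶜ B →
      O \ range f ⊆ A ∪ B → f p ∈ closure A := by
    intro A B hA hB hOs
    refine mem_closure_iff.2 fun W hW hpW ↦ ?_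
    obtain ⟨y, ⟨⟨hyO, hyW⟩, hyX⟩, hyB⟩ := not_subset.1 (hnot (O ∩ W) B (hO.inter hW) ⟨hpO, hpW⟩ hB)
    exact ⟨y, hyW, (hOs ⟨hyO, hyX⟩).resolve_right hyB⟩
  suffices h : ∃ A B, IsConnCompIn (range f)ᶜ A ∧ IsConnCompIn (range f)ᶜ B ∧ A ≠ B ∧
      O \ range f ⊆ A ∪ B by
    obtain ⟨A, B, hA, hB, hAB, hs⟩ := h
    exact ⟨O, A, B, hO, hpO, hA, hB, hAB, hs, hfin A B hA hB hs,
      hfin B A hB hA (by rwa [union_comm])⟩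
  obtain ⟨a, ⟨haO, haX⟩, haU⟩ := not_subset.1 (hnot O U₁ hO hpO hU₁)
  obtain ⟨A, hA, haA⟩ := exists_isConnCompIn_mem (S := (range f)ᶜ) haX
  have hAU : A ≠ U₁ := fun h ↦ haU (h ▸ haA)
  by_cases hs : O \ range f ⊆ A ∪ U₁
  · exact ⟨A, U₁, hA, hU₁, hAU, hs⟩
  obtain ⟨b, ⟨hbO, hbX⟩, hb⟩ := not_subset.1 hs
  rw [mem_union, not_or] at hb
  obtain ⟨B, hB, hbB⟩ := exists_isConnCompIn_mem (S := (range f)ᶜ) hbX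
  have hAB : A ≠ B := fun h ↦ hb.1 (h ▸ hbB)
  refine ⟨A, B, hA, hB, hAB, fun y hy ↦ ?_⟩
  exact (hOAB A B hA hB hAB hAU (fun h ↦ hb.2 (h ▸ hbB)) ⟨a, haO, haA⟩ ⟨b, hbO, hbB⟩
    hy.1).resolve_right hy.2

lemma mem_closure_of_isConnCompIn (hf : Continuous f) (hr0 : 0 < r) (hr : r < 1)
    (hinj : ∀ p, dist p x₀ ≤ r → ∀ q, f q = f p → q = p)
    {U₁ U₂ U : Set (sphere (0 : EuclideanSpace ℝ (Fin (n + 2))) 1)}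
    (hU₁ : IsConnCompIn (range f)ᶜ U₁) (hU₂ : IsConnCompIn (range f)ᶜ U₂) (hne : U₁ ≠ U₂)
    (hU : IsConnCompIn (range f)ᶜ U) (hUcl : (closure U ∩ f '' {x | dist x x₀ < r}).Nonempty)
    (hp : dist p x₀ < r) : f p ∈ closure U := by
  obtain ⟨_, hqU, q, hq, rfl⟩ := hUcl
  refine (isPreconnected_sphere_cap x₀ hr0 hr).induction₂
    (fun x y ↦ f x ∈ closure U ↔ f y ∈ closure U) (fun x hx ↦ ?_) (fun _ _ _ _ _ _ h h' ↦ h.trans h')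
    (fun _ _ _ _ h ↦ h.symm) hq hp |>.1 hqU
  obtain ⟨O, A, B, hO, hxO, hA, hB, hAB, hs, hxA, hxB⟩ :=
    exists_isOpen_two_sides hf hr hinj hU₁ hU₂ hne hx
  have hor : ∀ C, IsConnCompIn (range f)ᶜ C → ∀ w ∈ O, w ∈ closure C → C = A ∨ C = B := by
    intro C hC w hw hwC
    obtain ⟨y, hyO, hyC⟩ := mem_closure_iff.1 hwC O hO hw
    exact (hs ⟨hyO, hC.subset hyC⟩).imp (hC.eq_of_mem hA hyC) (hC.eq_of_mem hB hyC)
  filter_upwards [self_mem_nhdsWithin, nhdsWithin_le_nhds ((hO.preimage hf).mem_nhds hxO)] with y hy hyO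
  obtain ⟨-, A', B', -, -, hA', hB', hAB', -, hyA, hyB⟩ :=
    exists_isOpen_two_sides hf hr hinj hU₁ hU₂ hne hy
  have h1 := hor A' hA' _ hyO hyA
  have h2 := hor B' hB' _ hyO hyB
  have h3 : f x ∈ closure U → U = A ∨ U = B := hor U hU _ hxO
  have h4 : f y ∈ closure U → U = A ∨ U = B := hor U hU _ hyO
  have h5 : f y ∈ closure A ∧ f y ∈ closure B := by
    rcases h1 with rfl | rfl <;> rcases h2 with rfl | rfl
    exacts [(hAB' rfl).elim, ⟨hyA, hyB⟩, ⟨hyB, hyA⟩, (hAB' rfl).elim]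
  constructor
  · intro h
    rcases h3 h with rfl | rfl
    exacts [h5.1, h5.2]
  · intro h
    rcases h4 h with rfl | rfl
    exacts [hxA, hxB]

end Sphere

end Degree

/-- Let `n ≥ 1` and let `f : Sⁿ → Sⁿ⁺¹` be a continuous map whose set of
injectivity contains the closed metric ball `D` of radius `0 < r < 1` about `x₀ ∈ Sⁿ`, and
let `U₁, U₂` be the two connected components of `Sⁿ⁺¹ \ f(Sⁿ)` whose closures intersect
`f(D°)`.  Then for every `p ∈ D°`: (i) every ball `B(f(p), ε)` meets both `U₁` and `U₂`;
and (ii) there exists `ε > 0` with `B(f(p), ε) \ f(Sⁿ) ⊆ U₁ ∪ U₂`. -/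
theorem ball_meets_both_components_and_small_ball_in_union
    (n : ℕ) (hn : 1 ≤ n)
    (f : (Metric.sphere (0 : EuclideanSpace ℝ (Fin (n + 1))) 1) →
         (Metric.sphere (0 : EuclideanSpace ℝ (Fin (n + 2))) 1))
    (hf : Continuous f)
    (x₀ : Metric.sphere (0 : EuclideanSpace ℝ (Fin (n + 1))) 1)
    (r : ℝ) (hr0 : 0 < r) (hr1 : r < 1)
    (hinj : ∀ p, dist p x₀ ≤ r → ∀ q, f q = f p → q = p)
    (U₁ U₂ : Set (Metric.sphere (0 : EuclideanSpace ℝ (Fin (n + 2))) 1))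
    (hU₁ : IsConnCompIn (Set.range f)ᶜ U₁)
    (hU₂ : IsConnCompIn (Set.range f)ᶜ U₂)
    (hU₁cl : (closure U₁ ∩ f '' {x | dist x x₀ < r}).Nonempty)
    (hU₂cl : (closure U₂ ∩ f '' {x | dist x x₀ < r}).Nonempty)
    (hne : U₁ ≠ U₂)
    (p : Metric.sphere (0 : EuclideanSpace ℝ (Fin (n + 1))) 1)
    (hp : dist p x₀ < r) :
    (∀ ε : ℝ, 0 < ε →
        (Metric.ball (f p) ε ∩ U₁).Nonempty ∧ (Metric.ball (f p) ε ∩ U₂).Nonempty) ∧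
      ∃ ε : ℝ, 0 < ε ∧ Metric.ball (f p) ε \ Set.range f ⊆ U₁ ∪ U₂ := by
  have h₁ := mem_closure_of_isConnCompIn hf hr0 hr1 hinj hU₁ hU₂ hne hU₁ hU₁cl hp
  have h₂ := mem_closure_of_isConnCompIn hf hr0 hr1 hinj hU₁ hU₂ hne hU₂ hU₂cl hp
  refine ⟨fun ε hε ↦ ⟨mem_closure_iff.1 h₁ _ Metric.isOpen_ball (Metric.mem_ball_self hε),
    mem_closure_iff.1 h₂ _ Metric.isOpen_ball (Metric.mem_ball_self hε)⟩, ?_⟩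
  obtain ⟨O, A, B, hO, hpO, hA, hB, -, hs, -, -⟩ :=
    exists_isOpen_two_sides hf hr1 hinj hU₁ hU₂ hne hp
  have hor : ∀ C, IsConnCompIn (Set.range f)ᶜ C → f p ∈ closure C → C = A ∨ C = B := by
    intro C hC hpC
    obtain ⟨y, hyO, hyC⟩ := mem_closure_iff.1 hpC O hO hpO
    exact (hs ⟨hyO, hC.subset hyC⟩).imp (hC.eq_of_mem hA hyC) (hC.eq_of_mem hB hyC)
  obtain ⟨ε, hε, hεO⟩ := Metric.isOpen_iff.1 hO _ hpO
  refine ⟨ε, hε, (Set.sdiff_subset_sdiff_left hεO).trans (hs.trans ?_)⟩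
  rcases hor U₁ hU₁ h₁ with rfl | rfl <;> rcases hor U₂ hU₂ h₂ with rfl | rfl
  exacts [(hne rfl).elim, subset_rfl, (Set.union_comm _ _).subset, (hne rfl).elim]
end
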